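/- arXiv:2001.00490 — 2 statements merged into one kernel-verified Lean document; each statement's English description precedes it below -/
import Mathlib

section
/- Let α ∈ (0,1) and let f : ℝ² → ℝ be measurable with |f(x)| ≤ C·|x₂|^{α−1} for all x and f(x) = 0 whenever x₂ < 0. Then for all integers j, l ≥ 0 and every δ > 0 there is a constant C'(α, j, l, δ) such that for all T > 0 and L > 0, on the region ℝ²_L := ℝ × (−∞, −L]: (a) sup_{x ∈ ℝ²_L} |∂₁^j ∂₂^l (f * ψ_T)(x)| ≤ C' · C · L^{−δ} · T^{(2α − 2 − j − 2l + 2δ)/4}, and (b) the parabolic Hölder seminorm of f * ψ_T restricted to ℝ²_L is at most C'(α, δ) · C · L^{−δ} · T^{(α − 2 + 2δ)/4}. -/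
open MeasureTheory

/-- The parabolic distance on `ℝ²`. -/
noncomputable def pdist (x y : ℝ × ℝ) : ℝ := |x.1 - y.1| + Real.sqrt |x.2 - y.2|

/-- Partial derivative in the first (space-like) variable. -/
noncomputable def pd1 (f : ℝ × ℝ → ℝ) : ℝ × ℝ → ℝ := fun x => deriv (fun s => f (s, x.2)) x.1

/-- Partial derivative in the second (time-like) variable. -/
noncomputable def pd2 (f : ℝ × ℝ → ℝ) : ℝ × ℝ → ℝ := fun x => deriv (fun s => f (x.1, s)) x.2

def IsPsiKernel (ψ : ℝ → ℝ × ℝ → ℝ) : Prop :=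
  (∀ T : ℝ, 0 < T → ∃ φ : SchwartzMap (ℝ × ℝ) ℝ, ψ T = ⇑φ) ∧
  (∃ C : ℝ, ∀ T : ℝ, 0 < T → ∀ k : ℝ × ℝ,
      (∫ x : ℝ × ℝ,
          Complex.exp (-(2 * Real.pi * (k.1 * x.1 + k.2 * x.2) : ℝ) * Complex.I) * (ψ T x : ℂ))
        = (C : ℂ) * Complex.exp ((-(T * (k.1 ^ 4 + k.2 ^ 2)) : ℝ) : ℂ)) ∧
  (∫ x : ℝ × ℝ, |ψ 1 x|) = 1

/-- Measurable functions supported in the upper half-plane and blowing up at most like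
`Cf * |x₂| ^ (α - 1)` on the axis. -/
structure IsSingularForcing (α Cf : ℝ) (f : ℝ × ℝ → ℝ) : Prop where
  measurable : Measurable f
  bound : ∀ x : ℝ × ℝ, x.2 ≠ 0 → |f x| ≤ Cf * |x.2| ^ (α - 1)
  vanish : ∀ x : ℝ × ℝ, x.2 < 0 → f x = 0

/-- The convolution of `f` with `φ`. -/
noncomputable def planeConv (f φ : ℝ × ℝ → ℝ) : ℝ × ℝ → ℝ :=
  fun z => ∫ y : ℝ × ℝ, f y * φ (z - y)

/-- The one-sided singular profile `t ^ (α - 1)` for `t > 0`, and `0` otherwise. -/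
noncomputable def singularProfile (α : ℝ) : ℝ → ℝ :=
  (Set.Ioi 0).indicator fun t => t ^ (α - 1)

/-- An integrable majorant for singular forcings paired with decaying kernels. -/
noncomputable def singularWeight (α : ℝ) (y : ℝ × ℝ) : ℝ :=
  (1 + y.1 ^ 2)⁻¹ * (singularProfile α y.2 * (1 + y.2 ^ 2)⁻¹)

lemma singularProfile_nonneg (α t : ℝ) : 0 ≤ singularProfile α t :=
  Set.indicator_nonneg (fun _ hs => Real.rpow_nonneg (le_of_lt hs) _) t

lemma singularWeight_nonneg (α : ℝ) (y : ℝ × ℝ) : 0 ≤ singularWeight α y := by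
  have := singularProfile_nonneg α y.2
  unfold singularWeight
  positivity

lemma integrable_singularProfile_mul {α : ℝ} (hα : 0 < α) (hα1 : α < 1) :
    Integrable fun t : ℝ => singularProfile α t * (1 + t ^ 2)⁻¹ := by
  have hind : (fun t : ℝ => singularProfile α t * (1 + t ^ 2)⁻¹)
      = (Set.Ioi 0).indicator fun t => t ^ (α - 1) * (1 + t ^ 2)⁻¹ := by
    ext t
    by_cases ht : t ∈ Set.Ioi (0 : ℝ) <;> simp [singularProfile, ht]
  have hmeas : Measurable fun t : ℝ => t ^ (α - 1) * (1 + t ^ 2)⁻¹ := by fun_prop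
  rw [hind, integrable_indicator_iff measurableSet_Ioi,
    ← Set.Ioc_union_Ioi_eq_Ioi (zero_le_one' ℝ)]
  refine IntegrableOn.union ?_ ?_
  · have h := (intervalIntegral.intervalIntegrable_rpow' (a := 0) (b := 1)
      (show -1 < α - 1 by linarith)).1
    refine Integrable.mono' h hmeas.aestronglyMeasurable ?_
    filter_upwards [ae_restrict_mem measurableSet_Ioc] with t ht
    have h0 := Real.rpow_nonneg ht.1.le (α - 1)
    rw [Real.norm_of_nonneg (by positivity)]
    exact mul_le_of_le_one_right h0 (inv_le_one_of_one_le₀ (by nlinarith))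
  · refine Integrable.mono' integrable_inv_one_add_sq.integrableOn hmeas.aestronglyMeasurable ?_
    filter_upwards [ae_restrict_mem measurableSet_Ioi] with t ht
    have ht1 : 1 < t := ht
    have h0 := Real.rpow_nonneg (zero_le_one.trans ht1.le) (α - 1)
    rw [Real.norm_of_nonneg (by positivity)]
    exact mul_le_of_le_one_left (by positivity)
      (Real.rpow_le_one_of_one_le_of_nonpos ht1.le (by linarith))

lemma integrable_singularWeight {α : ℝ} (hα : 0 < α) (hα1 : α < 1) :
    Integrable (singularWeight α) :=
  Integrable.mul_prod integrable_inv_one_add_sq (integrable_singularProfile_mul hα hα1)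

lemma ae_snd_ne_zero : ∀ᵐ y : ℝ × ℝ, y.2 ≠ 0 :=
  (Measure.quasiMeasurePreserving_snd (μ := (volume : Measure ℝ))
    (ν := (volume : Measure ℝ))).ae (Measure.ae_ne volume 0)

namespace IsSingularForcing

variable {α Cf : ℝ} {f : ℝ × ℝ → ℝ}

lemma coeff_nonneg (hf : IsSingularForcing α Cf f) : 0 ≤ Cf := by
  simpa using (abs_nonneg _).trans (hf.bound (0, 1) (by simp))

lemma abs_le (hf : IsSingularForcing α Cf f) {y : ℝ × ℝ} (hy : y.2 ≠ 0) :
    |f y| ≤ Cf * singularProfile α y.2 := by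
  rcases lt_or_gt_of_ne hy with h | h
  · rw [hf.vanish y h, abs_zero]
    exact mul_nonneg hf.coeff_nonneg (singularProfile_nonneg _ _)
  · have := hf.bound y hy
    rw [abs_of_pos h] at this
    simpa [singularProfile, h] using this

end IsSingularForcing

lemma one_add_sq_mul_le (v : ℝ × ℝ) : (1 + v.1 ^ 2) * (1 + v.2 ^ 2) ≤ (1 + ‖v‖) ^ 4 := by
  have h1 : |v.1| ≤ ‖v‖ := norm_fst_le v
  have h2 : |v.2| ≤ ‖v‖ := norm_snd_le v
  have h1' : v.1 ^ 2 ≤ ‖v‖ ^ 2 := by rw [← sq_abs]; gcongr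
  have h2' : v.2 ^ 2 ≤ ‖v‖ ^ 2 := by rw [← sq_abs]; gcongr
  have h0 := norm_nonneg v
  calc (1 + v.1 ^ 2) * (1 + v.2 ^ 2) ≤ (1 + ‖v‖) ^ 2 * (1 + ‖v‖) ^ 2 := by
        gcongr <;> nlinarith
    _ = _ := by ring

lemma SchwartzMap.exists_decay_bound (φ : SchwartzMap (ℝ × ℝ) ℝ) (n : ℕ) :
    ∃ K : ℝ, 0 ≤ K ∧ ∀ v, (1 + ‖v‖) ^ n * |φ v| ≤ K := by
  have h (v : ℝ × ℝ) := SchwartzMap.one_add_le_sup_seminorm_apply (𝕜 := ℝ) (m := (n, 0))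
    (k := n) (n := 0) le_rfl le_rfl φ v
  simp only [norm_iteratedFDeriv_zero] at h
  exact ⟨_, le_trans (by positivity) (h 0), h⟩

lemma SchwartzMap.exists_translate_bound (φ : SchwartzMap (ℝ × ℝ) ℝ) :
    ∃ K : ℝ, 0 ≤ K ∧ ∀ z y : ℝ × ℝ,
      |φ (z - y)| ≤ K * (1 + ‖z‖) ^ 4 * ((1 + y.1 ^ 2)⁻¹ * (1 + y.2 ^ 2)⁻¹) := by
  obtain ⟨K, hK, h⟩ := φ.exists_decay_bound 4
  refine ⟨K, hK, fun z y => ?_⟩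
  rw [← mul_inv, ← div_eq_mul_inv, le_div_iff₀ (by positivity)]
  have hy : 1 + ‖y‖ ≤ (1 + ‖z‖) * (1 + ‖z - y‖) := by
    have := norm_sub_le z (z - y)
    rw [sub_sub_cancel] at this
    nlinarith [mul_nonneg (norm_nonneg z) (norm_nonneg (z - y))]
  calc |φ (z - y)| * ((1 + y.1 ^ 2) * (1 + y.2 ^ 2))
      ≤ |φ (z - y)| * ((1 + ‖z‖) * (1 + ‖z - y‖)) ^ 4 := by
        gcongr
        exact (one_add_sq_mul_le y).trans (by gcongr)
    _ = ((1 + ‖z - y‖) ^ 4 * |φ (z - y)|) * (1 + ‖z‖) ^ 4 := by ring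
    _ ≤ K * (1 + ‖z‖) ^ 4 := by gcongr; exact h _

lemma SchwartzMap.exists_moment_bound (φ : SchwartzMap (ℝ × ℝ) ℝ) {δ : ℝ} (hδ : 0 < δ) :
    ∃ K : ℝ, 0 ≤ K ∧ ∀ v : ℝ × ℝ,
      |v.2| ^ δ * |φ v| ≤ K * ((1 + v.1 ^ 2)⁻¹ * (1 + v.2 ^ 2)⁻¹) := by
  obtain ⟨n, hn⟩ := exists_nat_ge δ
  obtain ⟨K, hK, h⟩ := φ.exists_decay_bound (n + 4)
  refine ⟨K, hK, fun v => ?_⟩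
  rw [← mul_inv, ← div_eq_mul_inv, le_div_iff₀ (by positivity)]
  have h1 : |v.2| ^ δ ≤ (1 + ‖v‖) ^ n := by
    have h2 : |v.2| ≤ ‖v‖ := norm_snd_le v
    calc |v.2| ^ δ ≤ (1 + ‖v‖) ^ δ := by
          gcongr
          linarith
      _ ≤ (1 + ‖v‖) ^ (n : ℝ) :=
          Real.rpow_le_rpow_of_exponent_le (by linarith [norm_nonneg v]) hn
      _ = _ := Real.rpow_natCast _ _
  calc |v.2| ^ δ * |φ v| * ((1 + v.1 ^ 2) * (1 + v.2 ^ 2))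
      ≤ (1 + ‖v‖) ^ n * |φ v| * (1 + ‖v‖) ^ 4 := by
        gcongr
        exact one_add_sq_mul_le v
    _ = (1 + ‖v‖) ^ (n + 4) * |φ v| := by ring
    _ ≤ K := h v

section PlaneConv

open LineDeriv

variable {α Cf : ℝ} {f : ℝ × ℝ → ℝ}

lemma IsSingularForcing.ae_abs_mul_le (hf : IsSingularForcing α Cf f) {K : ℝ} :
    ∀ᵐ y : ℝ × ℝ, ∀ r : ℝ, |r| ≤ K * ((1 + y.1 ^ 2)⁻¹ * (1 + y.2 ^ 2)⁻¹) →
      ‖f y * r‖ ≤ Cf * K * singularWeight α y := by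
  filter_upwards [ae_snd_ne_zero] with y hy r hr
  have h0 := mul_nonneg hf.coeff_nonneg (singularProfile_nonneg α y.2)
  calc ‖f y * r‖ = |f y| * |r| := abs_mul _ _
    _ ≤ (Cf * singularProfile α y.2) * (K * ((1 + y.1 ^ 2)⁻¹ * (1 + y.2 ^ 2)⁻¹)) := by
        gcongr
        exact hf.abs_le hy
    _ = Cf * K * singularWeight α y := by unfold singularWeight; ring

lemma IsSingularForcing.integrable_mul (hf : IsSingularForcing α Cf f) (hα : 0 < α) (hα1 : α < 1)
    (φ : SchwartzMap (ℝ × ℝ) ℝ) (z : ℝ × ℝ) : Integrable fun y => f y * φ (z - y) := by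
  obtain ⟨K, -, h⟩ := φ.exists_translate_bound
  refine ((integrable_singularWeight hα hα1).const_mul (Cf * (K * (1 + ‖z‖) ^ 4))).mono'
    (hf.measurable.mul (φ.continuous.comp (by fun_prop)).measurable).aestronglyMeasurable ?_
  filter_upwards [hf.ae_abs_mul_le] with y hy
  exact hy _ (h z y)

lemma hasDerivAt_planeConv (hf : IsSingularForcing α Cf f) (hα : 0 < α) (hα1 : α < 1)
    (φ : SchwartzMap (ℝ × ℝ) ℝ) {γ : ℝ → ℝ × ℝ} {v : ℝ × ℝ} (hγ : ∀ s, HasDerivAt γ v s) (s : ℝ) :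
    HasDerivAt (fun s => planeConv f φ (γ s))
      (planeConv f (∂_{v} φ : SchwartzMap (ℝ × ℝ) ℝ) (γ s)) s := by
  set φ' : SchwartzMap (ℝ × ℝ) ℝ := ∂_{v} φ with hφ'
  obtain ⟨K, hK, h⟩ := φ'.exists_translate_bound
  have hcont : Continuous γ := continuous_iff_continuousAt.2 fun s => (hγ s).continuousAt
  obtain ⟨R, hR⟩ := (isCompact_closedBall s 1).exists_bound_of_continuousOn hcont.continuousOn
  refine (hasDerivAt_integral_of_dominated_loc_of_deriv_le
    (F := fun s y => f y * φ (γ s - y)) (F' := fun s y => f y * φ' (γ s - y))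
    (bound := fun y => Cf * (K * (1 + R) ^ 4) * singularWeight α y)
    (Metric.closedBall_mem_nhds s one_pos)
    (.of_forall fun t => (hf.integrable_mul hα hα1 φ _).aestronglyMeasurable)
    (hf.integrable_mul hα hα1 φ _) (hf.integrable_mul hα hα1 φ' _).aestronglyMeasurable ?_
    ((integrable_singularWeight hα hα1).const_mul _) ?_).2
  · filter_upwards [hf.ae_abs_mul_le (K := K * (1 + R) ^ 4)] with y hy t ht
    refine hy _ ((h (γ t) y).trans ?_)
    gcongr
    exact hR t ht
  · refine .of_forall fun y t _ => HasDerivAt.const_mul _ ?_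
    exact (φ.hasFDerivAt (γ t - y)).comp_hasDerivAt t ((hγ t).sub_const y)

lemma hasDerivAt_mk_left (b s : ℝ) : HasDerivAt (fun s : ℝ => (s, b)) ((1, 0) : ℝ × ℝ) s :=
  (hasDerivAt_id s).prodMk (hasDerivAt_const s b)

lemma hasDerivAt_mk_right (a s : ℝ) : HasDerivAt (fun s : ℝ => (a, s)) ((0, 1) : ℝ × ℝ) s :=
  (hasDerivAt_const s a).prodMk (hasDerivAt_id s)

lemma pd1_planeConv (hf : IsSingularForcing α Cf f) (hα : 0 < α) (hα1 : α < 1)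
    (φ : SchwartzMap (ℝ × ℝ) ℝ) :
    pd1 (planeConv f φ) = planeConv f (∂_{((1, 0) : ℝ × ℝ)} φ : SchwartzMap (ℝ × ℝ) ℝ) := by
  ext x
  exact (hasDerivAt_planeConv hf hα hα1 φ (hasDerivAt_mk_left x.2) x.1).deriv

lemma pd2_planeConv (hf : IsSingularForcing α Cf f) (hα : 0 < α) (hα1 : α < 1)
    (φ : SchwartzMap (ℝ × ℝ) ℝ) :
    pd2 (planeConv f φ) = planeConv f (∂_{((0, 1) : ℝ × ℝ)} φ : SchwartzMap (ℝ × ℝ) ℝ) := by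
  ext x
  exact (hasDerivAt_planeConv hf hα hα1 φ (hasDerivAt_mk_right x.1) x.2).deriv

lemma exists_iterate_planeConv (hα : 0 < α) (hα1 : α < 1) (φ : SchwartzMap (ℝ × ℝ) ℝ) (j l : ℕ) :
    ∃ χ : SchwartzMap (ℝ × ℝ) ℝ, ∀ (f : ℝ × ℝ → ℝ) (Cf : ℝ), IsSingularForcing α Cf f →
      pd1^[j] (pd2^[l] (planeConv f φ)) = planeConv f χ := by
  have h2 : ∃ χ : SchwartzMap (ℝ × ℝ) ℝ, ∀ (f : ℝ × ℝ → ℝ) (Cf : ℝ), IsSingularForcing α Cf f →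
      pd2^[l] (planeConv f φ) = planeConv f χ := by
    induction l with
    | zero => exact ⟨φ, fun _ _ _ => rfl⟩
    | succ l ih =>
      obtain ⟨χ, hχ⟩ := ih
      refine ⟨∂_{((0, 1) : ℝ × ℝ)} χ, fun f Cf hf => ?_⟩
      rw [Function.iterate_succ_apply', hχ f Cf hf, pd2_planeConv hf hα hα1]
  induction j with
  | zero => exact h2
  | succ j ih =>
    obtain ⟨χ, hχ⟩ := ih
    refine ⟨∂_{((1, 0) : ℝ × ℝ)} χ, fun f Cf hf => ?_⟩
    rw [Function.iterate_succ_apply', hχ f Cf hf, pd1_planeConv hf hα hα1]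

lemma exists_planeConv_far_field_bound (hα : 0 < α) (hα1 : α < 1) (φ : SchwartzMap (ℝ × ℝ) ℝ)
    {δ : ℝ} (hδ : 0 < δ) :
    ∃ C : ℝ, 0 ≤ C ∧ ∀ (f : ℝ × ℝ → ℝ) (Cf : ℝ), IsSingularForcing α Cf f →
      ∀ L : ℝ, 0 < L → ∀ x : ℝ × ℝ, x.2 ≤ -L →
        |planeConv f φ x| ≤ C * Cf * L ^ (-δ) := by
  obtain ⟨K, hK, h⟩ := φ.exists_moment_bound hδ
  set A : ℝ := ∫ s : ℝ, (1 + s ^ 2)⁻¹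
  set B : ℝ := ∫ t : ℝ, singularProfile α t * (1 + t ^ 2)⁻¹
  have hA : 0 ≤ A := integral_nonneg fun s => by positivity
  have hB : 0 ≤ B := integral_nonneg fun t =>
    mul_nonneg (singularProfile_nonneg _ _) (by positivity)
  refine ⟨K * (A * B), by positivity, fun f Cf hf L hL x hx => ?_⟩
  have hCf := hf.coeff_nonneg
  have hint : Integrable fun y : ℝ × ℝ => Cf * (K * L ^ (-δ)) *
      ((1 + (x.1 - y.1) ^ 2)⁻¹ * (singularProfile α y.2 * (1 + y.2 ^ 2)⁻¹)) :=
    (Integrable.mul_prod (integrable_inv_one_add_sq.comp_sub_left x.1)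
      (integrable_singularProfile_mul hα hα1)).const_mul _
  have hval : ∫ y : ℝ × ℝ, Cf * (K * L ^ (-δ)) *
      ((1 + (x.1 - y.1) ^ 2)⁻¹ * (singularProfile α y.2 * (1 + y.2 ^ 2)⁻¹))
      = K * (A * B) * Cf * L ^ (-δ) := by
    rw [integral_const_mul, Measure.volume_eq_prod,
      integral_prod_mul (fun s : ℝ => (1 + (x.1 - s) ^ 2)⁻¹)
        (fun t : ℝ => singularProfile α t * (1 + t ^ 2)⁻¹),
      integral_sub_left_eq_self (fun s : ℝ => (1 + s ^ 2)⁻¹) volume x.1]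
    ring
  rw [← hval]
  refine norm_integral_le_of_norm_le (f := fun y => f y * φ (x - y)) hint ?_
  filter_upwards [ae_snd_ne_zero] with y hy
  rw [Real.norm_eq_abs, abs_mul]
  rcases lt_or_gt_of_ne hy with hneg | hpos
  · rw [hf.vanish y hneg, abs_zero, zero_mul]
    have := singularProfile_nonneg α y.2
    positivity
  have hv : |(x - y).2| = y.2 - x.2 := by
    rw [Prod.snd_sub, abs_of_neg (by linarith)]; ring
  have hLv : L ^ δ ≤ |(x - y).2| ^ δ := by
    rw [hv]
    exact Real.rpow_le_rpow hL.le (by linarith) hδ.le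
  have hφ : |φ (x - y)| ≤ K * L ^ (-δ) * ((1 + (x.1 - y.1) ^ 2)⁻¹ * (1 + y.2 ^ 2)⁻¹) := by
    have hLδ : 0 < L ^ δ := Real.rpow_pos_of_pos hL δ
    have hsq : (1 + (x - y).2 ^ 2)⁻¹ ≤ (1 + y.2 ^ 2)⁻¹ := by
      rw [← sq_abs, hv]
      gcongr
      linarith
    rw [Real.rpow_neg hL.le]
    calc |φ (x - y)| = (L ^ δ)⁻¹ * (L ^ δ * |φ (x - y)|) := by field_simp
      _ ≤ (L ^ δ)⁻¹ * (|(x - y).2| ^ δ * |φ (x - y)|) := by gcongr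
      _ ≤ (L ^ δ)⁻¹ * (K * ((1 + (x - y).1 ^ 2)⁻¹ * (1 + (x - y).2 ^ 2)⁻¹)) := by
          exact mul_le_mul_of_nonneg_left (h _) (by positivity)
      _ ≤ (L ^ δ)⁻¹ * (K * ((1 + (x - y).1 ^ 2)⁻¹ * (1 + y.2 ^ 2)⁻¹)) := by gcongr
      _ = _ := by rw [Prod.fst_sub]; ring
  have h0 := mul_nonneg hCf (singularProfile_nonneg α y.2)
  calc |f y| * |φ (x - y)|
      ≤ (Cf * singularProfile α y.2) *
        (K * L ^ (-δ) * ((1 + (x.1 - y.1) ^ 2)⁻¹ * (1 + y.2 ^ 2)⁻¹)) := by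
        gcongr
        exact hf.abs_le hy
    _ = _ := by ring

lemma pdist_nonneg (x y : ℝ × ℝ) : 0 ≤ pdist x y := by unfold pdist; positivity

lemma exists_planeConv_holder_bound (hα : 0 < α) (hα1 : α < 1) (φ : SchwartzMap (ℝ × ℝ) ℝ)
    {δ : ℝ} (hδ : 0 < δ) :
    ∃ C : ℝ, ∀ (f : ℝ × ℝ → ℝ) (Cf : ℝ), IsSingularForcing α Cf f →
      ∀ L : ℝ, 0 < L → ∀ x y : ℝ × ℝ, x.2 ≤ -L → y.2 ≤ -L →
        |planeConv f φ x - planeConv f φ y| ≤ C * Cf * L ^ (-δ) * pdist x y ^ α := by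
  obtain ⟨C₀, hC₀, h₀⟩ := exists_planeConv_far_field_bound hα hα1 φ hδ
  obtain ⟨C₁, hC₁, h₁⟩ := exists_planeConv_far_field_bound hα hα1
    (∂_{((1, 0) : ℝ × ℝ)} φ : SchwartzMap (ℝ × ℝ) ℝ) hδ
  obtain ⟨C₂, hC₂, h₂⟩ := exists_planeConv_far_field_bound hα hα1
    (∂_{((0, 1) : ℝ × ℝ)} φ : SchwartzMap (ℝ × ℝ) ℝ) hδ
  refine ⟨2 * C₀ + C₁ + C₂, fun f Cf hf L hL x y hx hy => ?_⟩
  have hCf := hf.coeff_nonneg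
  set P : ℝ := Cf * L ^ (-δ) with hP
  have hP0 : 0 ≤ P := by positivity
  simp only [mul_assoc, ← hP] at h₀ h₁ h₂ ⊢
  set d := pdist x y with hd
  have hd0 : 0 ≤ d := pdist_nonneg x y
  rcases le_total 1 d with h1d | hd1
  · have hdα : 1 ≤ d ^ α := Real.one_le_rpow h1d hα.le
    calc |planeConv f φ x - planeConv f φ y|
        ≤ |planeConv f φ x| + |planeConv f φ y| := abs_sub _ _
      _ ≤ C₀ * P + C₀ * P := add_le_add (h₀ f Cf hf L hL x hx) (h₀ f Cf hf L hL y hy)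
      _ ≤ (2 * C₀ + C₁ + C₂) * P := by nlinarith [mul_nonneg hC₁ hP0, mul_nonneg hC₂ hP0]
      _ ≤ (2 * C₀ + C₁ + C₂) * P * d ^ α := le_mul_of_one_le_right (by positivity) hdα
      _ = _ := by ring
  · have hdα : d ≤ d ^ α := by
      simpa using Real.rpow_le_rpow_of_exponent_ge' hd0 hd1 hα.le hα1.le
    have hx1 : |x.1 - y.1| ≤ d := by
      rw [hd, pdist]; linarith [Real.sqrt_nonneg |x.2 - y.2|]
    have hs : √|x.2 - y.2| ≤ d := by rw [hd, pdist]; linarith [abs_nonneg (x.1 - y.1)]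
    have hx2 : |x.2 - y.2| ≤ d := by
      have := Real.sq_sqrt (abs_nonneg (x.2 - y.2))
      nlinarith [Real.sqrt_nonneg |x.2 - y.2|]
    have hm₁ : |planeConv f φ (x.1, x.2) - planeConv f φ (y.1, x.2)|
        ≤ C₁ * P * |x.1 - y.1| :=
      convex_univ.norm_image_sub_le_of_norm_hasDerivWithin_le
        (f := fun s => planeConv f φ (s, x.2))
        (fun s _ => (hasDerivAt_planeConv hf hα hα1 φ
          (hasDerivAt_mk_left x.2) s).hasDerivWithinAt)
        (fun s _ => h₁ f Cf hf L hL (s, x.2) hx) trivial trivial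
    have hm₂ : |planeConv f φ (y.1, x.2) - planeConv f φ (y.1, y.2)|
        ≤ C₂ * P * |x.2 - y.2| :=
      (convex_Iic (-L)).norm_image_sub_le_of_norm_hasDerivWithin_le
        (f := fun s => planeConv f φ (y.1, s))
        (fun s _ => (hasDerivAt_planeConv hf hα hα1 φ
          (hasDerivAt_mk_right y.1) s).hasDerivWithinAt)
        (fun s hs => h₂ f Cf hf L hL (y.1, s) hs) hy hx
    calc |planeConv f φ x - planeConv f φ y|
        ≤ |planeConv f φ (x.1, x.2) - planeConv f φ (y.1, x.2)|
          + |planeConv f φ (y.1, x.2) - planeConv f φ (y.1, y.2)| := abs_sub_le _ _ _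
      _ ≤ C₁ * P * |x.1 - y.1| + C₂ * P * |x.2 - y.2| := add_le_add hm₁ hm₂
      _ ≤ C₁ * P * d ^ α + C₂ * P * d ^ α := by
          gcongr
          · exact hx1.trans hdα
          · exact hx2.trans hdα
      _ ≤ (2 * C₀ + C₁ + C₂) * (P * d ^ α) := by
          have : 0 ≤ C₀ * P * d ^ α := by positivity
          linarith

end PlaneConv

/-- The anisotropic dilation `(x₁, x₂) ↦ (a x₁, b x₂)`. -/
def dilate (a b : ℝ) (x : ℝ × ℝ) : ℝ × ℝ := (a * x.1, b * x.2)

lemma measurableEmbedding_dilate {a b : ℝ} (ha : a ≠ 0) (hb : b ≠ 0) :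
    MeasurableEmbedding (dilate a b) :=
  ((Homeomorph.mulLeft₀ a ha).prodCongr (Homeomorph.mulLeft₀ b hb)).measurableEmbedding

lemma map_dilate_volume {a b : ℝ} (ha : 0 < a) (hb : 0 < b) :
    Measure.map (dilate a b) volume = ENNReal.ofReal (a * b)⁻¹ • (volume : Measure (ℝ × ℝ)) := by
  have := Measure.map_prod_map (volume : Measure ℝ) (volume : Measure ℝ)
    (measurable_const_mul a) (measurable_const_mul b)
  rw [Real.map_volume_mul_left ha.ne', Real.map_volume_mul_left hb.ne',
    Measure.prod_smul_left, Measure.prod_smul_right, smul_smul,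
    ← ENNReal.ofReal_mul (abs_nonneg _), ← abs_mul, ← mul_inv,
    abs_of_pos (by positivity)] at this
  exact this.symm

lemma integral_smul_comp_dilate {E : Type*} [NormedAddCommGroup E] [NormedSpace ℝ E] {a b : ℝ}
    (ha : 0 < a) (hb : 0 < b) (g : ℝ × ℝ → E) :
    ∫ x, (a * b) • g (dilate a b x) = ∫ x, g x := by
  rw [integral_smul, ← (measurableEmbedding_dilate ha.ne' hb.ne').integral_map,
    map_dilate_volume ha hb, integral_smul_measure, ENNReal.toReal_ofReal (by positivity),
    smul_inv_smul₀ (by positivity)]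

lemma integrable_comp_dilate {E : Type*} [NormedAddCommGroup E] {a b : ℝ}
    (ha : 0 < a) (hb : 0 < b) {g : ℝ × ℝ → E} (hg : Integrable g) :
    Integrable fun x => g (dilate a b x) := by
  have h := (measurableEmbedding_dilate ha.ne' hb.ne').integrable_map_iff (μ := volume) (g := g)
  rw [map_dilate_volume ha hb] at h
  exact h.1 (hg.smul_measure ENNReal.ofReal_ne_top)

/-- A continuous integrable function on the plane is determined by its Fourier transform. -/
lemma eq_zero_of_integral_char_eq_zero {g : ℝ × ℝ → ℂ} (hc : Continuous g) (hi : Integrable g)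
    (h : ∀ k : ℝ × ℝ, ∫ x : ℝ × ℝ,
      Complex.exp (-(2 * Real.pi * (k.1 * x.1 + k.2 * x.2) : ℝ) * Complex.I) * g x = 0) :
    g = 0 := by
  have hpres := WithLp.volume_preserving_ofLp ℝ ℝ
  have hemb : MeasurableEmbedding (@WithLp.ofLp 2 (ℝ × ℝ)) :=
    (MeasurableEquiv.toLp 2 (ℝ × ℝ)).symm.measurableEmbedding
  have hG : Continuous (g ∘ @WithLp.ofLp 2 (ℝ × ℝ)) :=
    hc.comp (WithLp.prod_continuous_ofLp 2 ℝ ℝ)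
  have hGi : Integrable (g ∘ @WithLp.ofLp 2 (ℝ × ℝ)) := (hpres.integrable_comp_emb hemb).2 hi
  have hF : FourierTransform.fourier (g ∘ @WithLp.ofLp 2 (ℝ × ℝ)) = 0 := by
    ext w
    rw [Real.fourier_eq', Pi.zero_apply, ← h w.ofLp, ← hpres.integral_comp hemb]
    congr 1 with v
    simp [WithLp.prod_inner_apply, mul_comm]
  have hinv := hG.fourierInv_fourier_eq hGi (by rw [hF]; exact integrable_zero _ _ _)
  rw [hF] at hinv
  ext x
  have := congrFun hinv (WithLp.toLp 2 x)
  simpa [Real.fourierInv_eq'] using this.symm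

lemma IsPsiKernel.eq_dilate {ψ : ℝ → ℝ × ℝ → ℝ} (hψ : IsPsiKernel ψ) {T a b : ℝ} (hT : 0 < T)
    (ha : 0 < a) (hb : 0 < b) (haT : a ^ 4 * T = 1) (hbT : b ^ 2 * T = 1) (z : ℝ × ℝ) :
    ψ T z = a * b * ψ 1 (dilate a b z) := by
  obtain ⟨hS, ⟨C, hC⟩, -⟩ := hψ
  obtain ⟨φ, hφ⟩ := hS T hT
  obtain ⟨χ, hχ⟩ := hS 1 one_pos
  have hdil : Continuous (dilate a b) := by unfold dilate; fun_prop
  have hi₁ : Integrable fun z => (ψ T z : ℂ) := by rw [hφ]; exact φ.integrable.ofReal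
  have hi₂ : Integrable fun z => ((a * b * ψ 1 (dilate a b z) : ℝ) : ℂ) := by
    rw [hχ]
    exact ((integrable_comp_dilate ha hb χ.integrable).const_mul (a * b)).ofReal
  have hc : Continuous fun z => (ψ T z : ℂ) - ((a * b * ψ 1 (dilate a b z) : ℝ) : ℂ) := by
    rw [hφ, hχ]
    have h₁ := φ.continuous
    have h₂ := χ.continuous.comp hdil
    exact (Complex.continuous_ofReal.comp h₁).sub
      (Complex.continuous_ofReal.comp (continuous_const.mul h₂))
  have hzero := eq_zero_of_integral_char_eq_zero hc (hi₁.sub hi₂) fun k => by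
    have hchar {g : ℝ × ℝ → ℂ} (hg : Integrable g) : Integrable fun x : ℝ × ℝ =>
        Complex.exp (-(2 * Real.pi * (k.1 * x.1 + k.2 * x.2) : ℝ) * Complex.I) * g x := by
      refine hg.bdd_mul (c := 1) (Continuous.aestronglyMeasurable (by fun_prop))
        (.of_forall fun x => ?_)
      rw [← Complex.ofReal_neg, Complex.norm_exp_ofReal_mul_I]
    have hD : ∫ x : ℝ × ℝ,
        Complex.exp (-(2 * Real.pi * (k.1 * x.1 + k.2 * x.2) : ℝ) * Complex.I)
          * ((a * b * ψ 1 (dilate a b x) : ℝ) : ℂ)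
        = C * Complex.exp ((-(T * (k.1 ^ 4 + k.2 ^ 2)) : ℝ) : ℂ) := by
      have hk : 1 * ((k.1 / a) ^ 4 + (k.2 / b) ^ 2) = T * (k.1 ^ 4 + k.2 ^ 2) := by
        have h4 : (a ^ 4)⁻¹ = T := inv_eq_of_mul_eq_one_right haT
        have h2 : (b ^ 2)⁻¹ = T := inv_eq_of_mul_eq_one_right hbT
        rw [div_pow, div_pow, div_eq_mul_inv, div_eq_mul_inv, h4, h2]
        ring
      rw [← hk, ← hC 1 one_pos (k.1 / a, k.2 / b)]
      rw [← integral_smul_comp_dilate ha hb fun x : ℝ × ℝ =>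
        Complex.exp (-(2 * Real.pi * (k.1 / a * x.1 + k.2 / b * x.2) : ℝ) * Complex.I)
          * (ψ 1 x : ℂ)]
      congr 1 with x
      have h1 : k.1 / a * (a * x.1) = k.1 * x.1 := by field_simp
      have h2 : k.2 / b * (b * x.2) = k.2 * x.2 := by field_simp
      simp only [dilate, h1, h2, Complex.real_smul]
      push_cast
      ring
    simp only [mul_sub]
    rw [integral_sub (hchar hi₁) (hchar hi₂), hC T hT k, hD, sub_self]
  exact_mod_cast sub_eq_zero.1 (congrFun hzero z)

lemma IsPsiKernel.planeConv_eq {ψ : ℝ → ℝ × ℝ → ℝ} (hψ : IsPsiKernel ψ) {T a b : ℝ} (hT : 0 < T)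
    (ha : 0 < a) (hb : 0 < b) (haT : a ^ 4 * T = 1) (hbT : b ^ 2 * T = 1) (f : ℝ × ℝ → ℝ) :
    planeConv f (ψ T)
      = fun x => planeConv (fun y => f (dilate a⁻¹ b⁻¹ y)) (ψ 1) (dilate a b x) := by
  ext x
  unfold planeConv
  rw [← integral_smul_comp_dilate ha hb fun w : ℝ × ℝ =>
    f (dilate a⁻¹ b⁻¹ w) * ψ 1 (dilate a b x - w)]
  congr 1 with y
  rw [hψ.eq_dilate hT ha hb haT hbT]
  have h1 : dilate a⁻¹ b⁻¹ (dilate a b y) = y := by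
    ext <;> simp [dilate, ha.ne', hb.ne']
  have h2 : dilate a b (x - y) = dilate a b x - dilate a b y := by
    ext <;> simp [dilate, mul_sub]
  rw [h1, h2, smul_eq_mul]
  ring

lemma IsSingularForcing.comp_dilate {α Cf : ℝ} {f : ℝ × ℝ → ℝ} (hf : IsSingularForcing α Cf f)
    (a : ℝ) {b : ℝ} (hb : 0 < b) :
    IsSingularForcing α (Cf * b ^ (1 - α)) fun y => f (dilate a⁻¹ b⁻¹ y) where
  measurable := hf.measurable.comp (by unfold dilate; fun_prop)
  bound x hx := by
    refine (hf.bound _ (mul_ne_zero (inv_ne_zero hb.ne') hx)).trans_eq ?_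
    simp only [dilate]
    rw [abs_mul, abs_of_pos (inv_pos.2 hb), Real.mul_rpow (inv_pos.2 hb).le (abs_nonneg _),
      Real.inv_rpow hb.le, ← Real.rpow_neg hb.le, neg_sub, mul_assoc]
  vanish x hx := hf.vanish _ (mul_neg_of_pos_of_neg (inv_pos.2 hb) hx)

lemma pd1_iterate_comp_dilate (a b c : ℝ) (G : ℝ × ℝ → ℝ) (j : ℕ) :
    pd1^[j] (fun x => c * G (dilate a b x)) = fun x => c * a ^ j * pd1^[j] G (dilate a b x) := by
  induction j with
  | zero => simp
  | succ j ih =>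
    rw [Function.iterate_succ_apply', ih, Function.iterate_succ_apply']
    ext x
    simp only [pd1, dilate]
    rw [deriv_const_mul_field, deriv_comp_mul_left a (fun s => pd1^[j] G (s, b * x.2)),
      smul_eq_mul]
    ring

lemma pd2_iterate_comp_dilate (a b c : ℝ) (G : ℝ × ℝ → ℝ) (l : ℕ) :
    pd2^[l] (fun x => c * G (dilate a b x)) = fun x => c * b ^ l * pd2^[l] G (dilate a b x) := by
  induction l with
  | zero => simp
  | succ l ih =>
    rw [Function.iterate_succ_apply', ih, Function.iterate_succ_apply']
    ext x
    simp only [pd2, dilate]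
    rw [deriv_const_mul_field, deriv_comp_mul_left b (fun s => pd2^[l] G (a * x.1, s)),
      smul_eq_mul]
    ring

lemma pdist_dilate {a b : ℝ} (ha : 0 < a) (hab : b = a ^ 2) (x y : ℝ × ℝ) :
    pdist (dilate a b x) (dilate a b y) = a * pdist x y := by
  simp only [pdist, dilate]
  rw [← mul_sub, ← mul_sub, abs_mul, abs_mul, abs_of_pos ha, hab, abs_of_pos (pow_pos ha 2),
    Real.sqrt_mul (by positivity), Real.sqrt_sq ha.le]
  ring

/-- improved bounds for `f * ψ_T` far below the axis when `f`
vanishes for negative times. -/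
theorem convolution_bounds_singular_forcing_far_field
    (ψ : ℝ → ℝ × ℝ → ℝ) (hψ : IsPsiKernel ψ)
    (α : ℝ) (hα : 0 < α) (hα1 : α < 1) :
    (∀ j l : ℕ, ∀ δ : ℝ, 0 < δ → ∃ C' : ℝ,
      ∀ (f : ℝ × ℝ → ℝ) (Cf : ℝ), Measurable f →
      (∀ x : ℝ × ℝ, x.2 ≠ 0 → |f x| ≤ Cf * |x.2| ^ (α - 1)) →
      (∀ x : ℝ × ℝ, x.2 < 0 → f x = 0) →
      ∀ T : ℝ, 0 < T → ∀ L : ℝ, 0 < L → ∀ x : ℝ × ℝ, x.2 ≤ -L →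
        |(pd1^[j] (pd2^[l] (fun z : ℝ × ℝ => ∫ y : ℝ × ℝ, f y * ψ T (z - y)))) x|
          ≤ C' * Cf * L ^ (-δ) * T ^ ((2 * α - 2 - (j : ℝ) - 2 * (l : ℝ) + 2 * δ) / 4)) ∧
    (∀ δ : ℝ, 0 < δ → ∃ C'' : ℝ,
      ∀ (f : ℝ × ℝ → ℝ) (Cf : ℝ), Measurable f →
      (∀ x : ℝ × ℝ, x.2 ≠ 0 → |f x| ≤ Cf * |x.2| ^ (α - 1)) →
      (∀ x : ℝ × ℝ, x.2 < 0 → f x = 0) →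
      ∀ T : ℝ, 0 < T → ∀ L : ℝ, 0 < L → ∀ x y : ℝ × ℝ, x.2 ≤ -L → y.2 ≤ -L →
        |(∫ z : ℝ × ℝ, f z * ψ T (x - z)) - (∫ z : ℝ × ℝ, f z * ψ T (y - z))|
          ≤ C'' * Cf * L ^ (-δ) * T ^ ((α - 2 + 2 * δ) / 4) * pdist x y ^ α) := by
  obtain ⟨φ, hφ⟩ := hψ.1 1 one_pos
  have hpow {T : ℝ} (hT : 0 < T) (r s : ℝ) : (T ^ r) ^ s = T ^ (r * s) :=
    (Real.rpow_mul hT.le r s).symm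
  have hpowN {T : ℝ} (hT : 0 < T) (r : ℝ) (n : ℕ) : (T ^ r) ^ n = T ^ (r * n) := by
    rw [← Real.rpow_natCast, hpow hT]
  have ha {T : ℝ} (hT : 0 < T) : 0 < T ^ (-1 / 4 : ℝ) := Real.rpow_pos_of_pos hT _
  have hb {T : ℝ} (hT : 0 < T) : 0 < T ^ (-1 / 2 : ℝ) := Real.rpow_pos_of_pos hT _
  have haT {T : ℝ} (hT : 0 < T) : (T ^ (-1 / 4 : ℝ)) ^ 4 * T = 1 := by
    rw [hpowN hT]
    norm_num [Real.rpow_neg_one, hT.ne']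
  have hbT {T : ℝ} (hT : 0 < T) : (T ^ (-1 / 2 : ℝ)) ^ 2 * T = 1 := by
    rw [hpowN hT]
    norm_num [Real.rpow_neg_one, hT.ne']
  have hdil {b L : ℝ} (hb : 0 < b) {x : ℝ × ℝ} (a : ℝ) (hx : x.2 ≤ -L) :
      (dilate a b x).2 ≤ -(b * L) := by
    simp only [dilate]
    nlinarith
  refine ⟨fun j l δ hδ => ?_, fun δ hδ => ?_⟩
  · obtain ⟨χ, hχ⟩ := exists_iterate_planeConv hα hα1 φ j l
    obtain ⟨C, -, hC⟩ := exists_planeConv_far_field_bound hα hα1 χ hδ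
    refine ⟨C, fun f Cf hm hbd hv T hT L hL x hx => ?_⟩
    have hf := IsSingularForcing.comp_dilate ⟨hm, hbd, hv⟩ (T ^ (-1 / 4 : ℝ)) (hb hT)
    change |(pd1^[j] (pd2^[l] (planeConv f (ψ T)))) x| ≤ _
    have h2 := pd2_iterate_comp_dilate (T ^ (-1 / 4 : ℝ)) (T ^ (-1 / 2 : ℝ)) 1
      (planeConv (fun y => f (dilate (T ^ (-1 / 4 : ℝ))⁻¹ (T ^ (-1 / 2 : ℝ))⁻¹ y)) φ) l
    simp only [one_mul] at h2
    rw [hψ.planeConv_eq hT (ha hT) (hb hT) (haT hT) (hbT hT), hφ, h2,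
      pd1_iterate_comp_dilate, hχ _ _ hf, abs_mul,
      abs_of_pos (mul_pos (pow_pos (hb hT) l) (pow_pos (ha hT) j))]
    refine (mul_le_mul_of_nonneg_left
      (hC _ _ hf _ (mul_pos (hb hT) hL) _ (hdil (hb hT) _ hx)) (by positivity)).trans_eq ?_
    rw [Real.mul_rpow (hb hT).le hL.le, hpowN hT, hpowN hT, hpow hT, hpow hT,
      show (2 * α - 2 - (j : ℝ) - 2 * (l : ℝ) + 2 * δ) / 4
        = -1 / 2 * l + -1 / 4 * j + -1 / 2 * (1 - α) + -1 / 2 * -δ by ring,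
      Real.rpow_add hT, Real.rpow_add hT, Real.rpow_add hT]
    ring
  · obtain ⟨C, hC⟩ := exists_planeConv_holder_bound hα hα1 φ hδ
    refine ⟨C, fun f Cf hm hbd hv T hT L hL x y hx hy => ?_⟩
    have hf := IsSingularForcing.comp_dilate ⟨hm, hbd, hv⟩ (T ^ (-1 / 4 : ℝ)) (hb hT)
    change |planeConv f (ψ T) x - planeConv f (ψ T) y| ≤ _
    rw [hψ.planeConv_eq hT (ha hT) (hb hT) (haT hT) (hbT hT), hφ]
    refine (hC _ _ hf _ (mul_pos (hb hT) hL) _ _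
      (hdil (hb hT) _ hx) (hdil (hb hT) _ hy)).trans_eq ?_
    rw [pdist_dilate (ha hT) (by rw [hpowN hT]; norm_num), Real.mul_rpow (hb hT).le hL.le,
      Real.mul_rpow (ha hT).le (pdist_nonneg x y), hpow hT, hpow hT, hpow hT,
      show (α - 2 + 2 * δ) / 4 = -1 / 2 * (1 - α) + -1 / 2 * -δ + -1 / 4 * α by ring,
      Real.rpow_add hT, Real.rpow_add hT]
    ring
end

section
/- Let α ∈ (0,1), λ > 0, and a₀ ∈ [λ,1]. Let f¹, f², f³ : ℝ² → ℝ be 1-periodic (in both coordinates) functions with finite parabolic Hölder seminorms and f³ bounded. Suppose v : ℝ² × [λ,1] → ℝ is such that for each a₀ ∈ [λ,1], v(·, a₀) is 1-periodic in both coordinates, has finite parabolic C^α-norm, and solves (∂₂ − a₀∂₁² + 1)v(·, a₀) = ∂₁²f¹ + ∂₂f² + f³ distributionally on ℝ², and that a₀ ↦ v(x, a₀) is twice continuously differentiable with ∂_{a₀}v(·, a₀) and ∂_{a₀}²v(·, a₀) of class C^α solving distributionally the differentiated equations (∂₂ − a₀∂₁² + 1)∂_{a₀}v = ∂₁²v and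 (∂₂ − a₀∂₁² + 1)∂_{a₀}²v = 2∂₁²∂_{a₀}v. Then there is a constant C(α, λ) such that sup_{a₀ ∈ [λ,1]} max_{m ≤ 2} (‖∂_{a₀}^m v(·, a₀)‖_{L^∞} + [∂_{a₀}^m v(·, a₀)]_α) ≤ C · ([f¹]_α + [f²]_α + [f³]_α + ‖f³‖_{L^∞}). -/
open MeasureTheory

/-! ### Gaussian weights and integration by parts -/

/-- The unnormalised Gaussian weight. -/
noncomputable def gaussWeight (z : ℝ) : ℝ := Real.exp (-(1 / 2) * z ^ 2)

theorem gaussWeight_pos (z : ℝ) : 0 < gaussWeight z := Real.exp_pos _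

theorem continuous_gaussWeight : Continuous gaussWeight := by
  unfold gaussWeight; fun_prop

theorem integrable_pow_mul_gaussWeight (n : ℕ) :
    Integrable (fun z : ℝ => z ^ n * gaussWeight z) := by
  have h := integrable_rpow_mul_exp_neg_mul_sq (b := 1 / 2) (by norm_num) (s := n)
    (by have : (0 : ℝ) ≤ n := n.cast_nonneg
        linarith)
  simpa [gaussWeight, Real.rpow_natCast] using h

theorem integrable_gaussWeight : Integrable gaussWeight := by
  simpa using integrable_pow_mul_gaussWeight 0

theorem integrable_mul_gaussWeight : Integrable (fun z : ℝ => z * gaussWeight z) := by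
  simpa using integrable_pow_mul_gaussWeight 1

theorem integrable_sq_sub_one_mul_gaussWeight :
    Integrable (fun z : ℝ => (z ^ 2 - 1) * gaussWeight z) := by
  refine ((integrable_pow_mul_gaussWeight 2).sub integrable_gaussWeight).congr ?_
  exact Filter.Eventually.of_forall fun z => by simp; ring

theorem integrable_abs_mul {q : ℝ → ℝ} (h : Integrable fun z => z * q z) :
    Integrable fun z => |z| * |q z| := by
  simpa [abs_mul] using h.abs

theorem integrable_one_add_abs_mul {q : ℝ → ℝ} (h0 : Integrable q)
    (h1 : Integrable fun z => z * q z) : Integrable fun z => (1 + |z|) * |q z| := by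
  refine (h0.abs.add (integrable_abs_mul h1)).congr ?_
  exact Filter.Eventually.of_forall fun z => by simp; ring

theorem integrable_mul_mul_gaussWeight :
    Integrable (fun z : ℝ => z * (z * gaussWeight z)) :=
  (integrable_pow_mul_gaussWeight 2).congr (Filter.Eventually.of_forall fun z => by simp; ring)

theorem integrable_mul_sq_sub_one_mul_gaussWeight :
    Integrable (fun z : ℝ => z * ((z ^ 2 - 1) * gaussWeight z)) := by
  refine ((integrable_pow_mul_gaussWeight 3).sub integrable_mul_gaussWeight).congr ?_
  exact Filter.Eventually.of_forall fun z => by simp; ring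

theorem hasDerivAt_gaussWeight (z : ℝ) : HasDerivAt gaussWeight (-(z * gaussWeight z)) z := by
  have h : HasDerivAt (fun z : ℝ => -(1 / 2) * z ^ 2) (-z) z :=
    ((hasDerivAt_pow 2 z).const_mul (-(1 / 2) : ℝ)).congr_deriv (by norm_num; ring)
  exact h.exp.congr_deriv (by unfold gaussWeight; ring)

theorem hasDerivAt_mul_gaussWeight (z : ℝ) :
    HasDerivAt (fun z => z * gaussWeight z) (-((z ^ 2 - 1) * gaussWeight z)) z :=
  ((hasDerivAt_id z).mul (hasDerivAt_gaussWeight z)).congr_deriv (by simp only [id]; ring)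

theorem Continuous.integrable_mul_of_bound {H q : ℝ → ℝ} (hH : Continuous H) {K : ℝ}
    (hK : ∀ y, |H y| ≤ K) (hq : Integrable q) : Integrable fun z => H z * q z :=
  hq.bdd_mul hH.aestronglyMeasurable (Filter.Eventually.of_forall hK)

/-- Integration by parts against an integrable weight, after an affine change of variables. -/
theorem mul_integral_deriv_comp_affine {H H' q q' : ℝ → ℝ} (hH : ∀ y, HasDerivAt H (H' y) y)
    (hH' : Continuous H') {K : ℝ} (hK : ∀ y, |H y| ≤ K) (hK' : ∀ y, |H' y| ≤ K)
    (hq : ∀ z, HasDerivAt q (-(q' z)) z) (iq : Integrable q) (iq' : Integrable q') (x r : ℝ) :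
    r * ∫ z, H' (x + r * z) * q z = ∫ z, H (x + r * z) * q' z := by
  have hHc : Continuous H := continuous_iff_continuousAt.2 fun y => (hH y).continuousAt
  have hc : Continuous fun z : ℝ => x + r * z := by fun_prop
  have i1 := (hHc.comp hc).integrable_mul_of_bound (fun y => hK _) iq
  have i2 := (hHc.comp hc).integrable_mul_of_bound (fun y => hK _) iq'
  have i3 := ((hH'.comp hc).integrable_mul_of_bound (fun y => hK' _) iq).const_mul r
  have hd : ∀ z, HasDerivAt (fun z => H (x + r * z)) (r * H' (x + r * z)) z := fun z => by
    have h1 : HasDerivAt (fun z : ℝ => x + r * z) r z := by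
      simpa using ((hasDerivAt_id z).const_mul r).const_add x
    have h2 := (hH (x + r * z)).comp z h1
    simpa [mul_comm, Function.comp_def] using h2
  have := integral_mul_deriv_eq_deriv_mul_of_integrable (u := fun z => H (x + r * z)) (v := q)
    (u' := fun z => r * H' (x + r * z)) (v' := fun z => -(q' z)) (fun z _ => hd z)
    (fun z _ => hq z)
    (by refine i2.neg.congr (Filter.Eventually.of_forall fun z => ?_); simp)
    (by refine i3.congr (Filter.Eventually.of_forall fun z => ?_); simp; ring) i1
  simp only [mul_neg, integral_neg, neg_inj] at this
  rw [this, ← integral_const_mul]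
  congr 1; ext z; ring

theorem abs_integral_sub_mul_le {H q : ℝ → ℝ} {A α r c x : ℝ} (hα : 0 ≤ α) (hα1 : α ≤ 1)
    (hr : 0 ≤ r) (hA : 0 ≤ A) (hH : ∀ z, |H (x + r * z) - c| ≤ A * |r * z| ^ α)
    (iq : Integrable q) (iq1 : Integrable fun z => z * q z) :
    |∫ z, (H (x + r * z) - c) * q z| ≤ A * r ^ α * ∫ z, (1 + |z|) * |q z| := by
  rw [← integral_const_mul, ← Real.norm_eq_abs]
  refine norm_integral_le_of_norm_le ((integrable_one_add_abs_mul iq iq1).const_mul _)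
    (Filter.Eventually.of_forall fun z => ?_)
  rw [Real.norm_eq_abs, abs_mul, ← mul_assoc]
  refine mul_le_mul_of_nonneg_right ((hH z).trans ?_) (abs_nonneg _)
  rw [mul_assoc]
  refine mul_le_mul_of_nonneg_left ?_ hA
  rw [abs_mul, abs_of_nonneg hr, Real.mul_rpow hr (abs_nonneg z)]
  refine mul_le_mul_of_nonneg_left ?_ (Real.rpow_nonneg hr _)
  calc |z| ^ α ≤ (1 + |z|) ^ α := Real.rpow_le_rpow (abs_nonneg _) (by linarith) hα
    _ ≤ (1 + |z|) ^ (1 : ℝ) := Real.rpow_le_rpow_of_exponent_le (by linarith [abs_nonneg z]) hα1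
    _ = 1 + |z| := Real.rpow_one _

/-- The gain of one derivative from averaging a Hölder function. -/
theorem mul_abs_integral_deriv_le {H H' : ℝ → ℝ} (hH : ∀ y, HasDerivAt H (H' y) y)
    (hH' : Continuous H') {K : ℝ} (hK : ∀ y, |H y| ≤ K) (hK' : ∀ y, |H' y| ≤ K) {A α r : ℝ}
    (hα : 0 ≤ α) (hα1 : α ≤ 1) (hr : 0 ≤ r) (hA : 0 ≤ A)
    (hHol : ∀ x y, |H x - H y| ≤ A * |x - y| ^ α) (x : ℝ) :
    r * |∫ z, H' (x + r * z) * gaussWeight z|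
      ≤ A * r ^ α * ∫ z, (1 + |z|) * |z * gaussWeight z| := by
  have hK0 : 0 ≤ K := (abs_nonneg _).trans (hK 0)
  nth_rw 1 [← abs_of_nonneg hr]
  rw [← abs_mul,
    mul_integral_deriv_comp_affine (H := fun y => H y - H x) (K := 2 * K)
    (fun y => (hH y).sub_const _) hH'
    (fun y => by have := abs_sub (H y) (H x); linarith [hK y, hK x])
    (fun y => (hK' y).trans (by linarith)) hasDerivAt_gaussWeight
    integrable_gaussWeight integrable_mul_gaussWeight x r]
  exact abs_integral_sub_mul_le hα hα1 hr hA (fun z => by simpa using hHol (x + r * z) x)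
    integrable_mul_gaussWeight integrable_mul_mul_gaussWeight

/-- The gain of two derivatives from averaging a Hölder function. -/
theorem sq_mul_abs_integral_deriv_deriv_le {H H' H'' : ℝ → ℝ}
    (hH : ∀ y, HasDerivAt H (H' y) y) (hH' : ∀ y, HasDerivAt H' (H'' y) y)
    (hH'' : Continuous H'') {K : ℝ} (hK : ∀ y, |H y| ≤ K) (hK' : ∀ y, |H' y| ≤ K)
    (hK'' : ∀ y, |H'' y| ≤ K) {A α r : ℝ}
    (hα : 0 ≤ α) (hα1 : α ≤ 1) (hr : 0 ≤ r) (hA : 0 ≤ A)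
    (hHol : ∀ x y, |H x - H y| ≤ A * |x - y| ^ α) (x : ℝ) :
    r ^ 2 * |∫ z, H'' (x + r * z) * gaussWeight z|
      ≤ A * r ^ α * ∫ z, (1 + |z|) * |(z ^ 2 - 1) * gaussWeight z| := by
  have hK0 : 0 ≤ K := (abs_nonneg _).trans (hK 0)
  have hc' : Continuous H' := continuous_iff_continuousAt.2 fun y => (hH' y).continuousAt
  rw [← abs_of_nonneg (sq_nonneg r), ← abs_mul, sq, mul_assoc,
    mul_integral_deriv_comp_affine hH' hH'' hK' hK'' hasDerivAt_gaussWeight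
      integrable_gaussWeight integrable_mul_gaussWeight x r,
    mul_integral_deriv_comp_affine (H := fun y => H y - H x) (K := 2 * K)
    (fun y => (hH y).sub_const _) hc'
    (fun y => by have := abs_sub (H y) (H x); linarith [hK y, hK x])
    (fun y => (hK' y).trans (by linarith)) hasDerivAt_mul_gaussWeight
    integrable_mul_gaussWeight integrable_sq_sub_one_mul_gaussWeight x r]
  exact abs_integral_sub_mul_le hα hα1 hr hA (fun z => by simpa using hHol (x + r * z) x)
    integrable_sq_sub_one_mul_gaussWeight integrable_mul_sq_sub_one_mul_gaussWeight

/-! ### Partial derivatives -/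

theorem DifferentiableAt.hasDerivAt_pd1 {f : ℝ × ℝ → ℝ} {s t : ℝ}
    (h : DifferentiableAt ℝ f (s, t)) : HasDerivAt (fun s => f (s, t)) (pd1 f (s, t)) s := by
  have hc : DifferentiableAt ℝ (fun s : ℝ => (s, t)) s := by fun_prop
  exact (DifferentiableAt.comp s h hc).hasDerivAt

theorem DifferentiableAt.pd1_eq {f : ℝ × ℝ → ℝ} {p : ℝ × ℝ} (h : DifferentiableAt ℝ f p) :
    pd1 f p = fderiv ℝ f p (1, 0) := by
  have hc : HasDerivAt (fun s : ℝ => (s, p.2)) ((1, 0) : ℝ × ℝ) p.1 :=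
    (hasDerivAt_id p.1).prodMk (hasDerivAt_const p.1 p.2)
  exact (HasFDerivAt.comp_hasDerivAt p.1 (f := fun s : ℝ => (s, p.2)) h.hasFDerivAt hc).deriv

theorem DifferentiableAt.pd2_eq {f : ℝ × ℝ → ℝ} {p : ℝ × ℝ} (h : DifferentiableAt ℝ f p) :
    pd2 f p = fderiv ℝ f p (0, 1) := by
  have hc : HasDerivAt (fun s : ℝ => (p.1, s)) ((0, 1) : ℝ × ℝ) p.2 :=
    (hasDerivAt_const p.2 p.1).prodMk (hasDerivAt_id p.2)
  exact (HasFDerivAt.comp_hasDerivAt p.2 (f := fun s : ℝ => (p.1, s)) h.hasFDerivAt hc).deriv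

theorem DifferentiableAt.fderiv_apply_eq_pd {f : ℝ × ℝ → ℝ} {p : ℝ × ℝ}
    (h : DifferentiableAt ℝ f p) (u v : ℝ) : fderiv ℝ f p (u, v) = u * pd1 f p + v * pd2 f p := by
  rw [h.pd1_eq, h.pd2_eq, ← smul_eq_mul, ← smul_eq_mul, ← map_smul, ← map_smul, ← map_add]
  simp

theorem ContDiff.pd1 {f : ℝ × ℝ → ℝ} (hf : ContDiff ℝ (⊤ : ℕ∞) f) :
    ContDiff ℝ (⊤ : ℕ∞) (pd1 f) := by
  have : _root_.pd1 f = fun p => fderiv ℝ f p (1, 0) :=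
    funext fun p => (hf.differentiable (by simp) p).pd1_eq
  rw [this]
  exact (hf.fderiv_right (m := (⊤ : ℕ∞)) (by simp)).clm_apply contDiff_const

theorem ContDiff.pd2 {f : ℝ × ℝ → ℝ} (hf : ContDiff ℝ (⊤ : ℕ∞) f) :
    ContDiff ℝ (⊤ : ℕ∞) (pd2 f) := by
  have : _root_.pd2 f = fun p => fderiv ℝ f p (0, 1) :=
    funext fun p => (hf.differentiable (by simp) p).pd2_eq
  rw [this]
  exact (hf.fderiv_right (m := (⊤ : ℕ∞)) (by simp)).clm_apply contDiff_const

/-- Smooth functions, bounded together with the derivatives entering the heat operator. -/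
structure IsBoundedSmooth (W : ℝ × ℝ → ℝ) : Prop where
  contDiff : ContDiff ℝ (⊤ : ℕ∞) W
  bounded : ∃ K, ∀ p, |W p| ≤ K ∧ |pd1 W p| ≤ K ∧ |pd2 W p| ≤ K ∧ |pd1 (pd1 W) p| ≤ K

namespace IsBoundedSmooth

variable {W : ℝ × ℝ → ℝ}

theorem differentiable (hW : IsBoundedSmooth W) : Differentiable ℝ W :=
  hW.contDiff.differentiable (by simp)

end IsBoundedSmooth

/-! ### Duhamel's formula along the heat flow -/

/-- Gaussian average in space at parabolic scale `σ`, backwards in time. -/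
noncomputable def heatAvg (W : ℝ × ℝ → ℝ) (b x T σ : ℝ) : ℝ :=
  ∫ z, W (x + b * σ * z, T - σ ^ 2) * gaussWeight z

theorem heatAvg_zero (W : ℝ × ℝ → ℝ) (b x T : ℝ) :
    heatAvg W b x T 0 = (∫ z, gaussWeight z) * W (x, T) := by
  simp [heatAvg, mul_comm (W (x, T)), integral_mul_const]

theorem integrable_heatAvg {W : ℝ × ℝ → ℝ} (hc : Continuous W) {K : ℝ} (hK : ∀ p, |W p| ≤ K)
    (b x T σ : ℝ) : Integrable fun z => W (x + b * σ * z, T - σ ^ 2) * gaussWeight z :=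
  Continuous.integrable_mul_of_bound (by fun_prop) (fun z => hK _) integrable_gaussWeight

theorem abs_heatAvg_le {W : ℝ × ℝ → ℝ} {K : ℝ} (hK : ∀ p, |W p| ≤ K) (b x T σ : ℝ) :
    |heatAvg W b x T σ| ≤ K * ∫ z, gaussWeight z := by
  rw [← integral_const_mul, ← Real.norm_eq_abs]
  refine norm_integral_le_of_norm_le (integrable_gaussWeight.const_mul _)
    (Filter.Eventually.of_forall fun z => ?_)
  rw [Real.norm_eq_abs, abs_mul, abs_of_pos (gaussWeight_pos z)]
  exact mul_le_mul_of_nonneg_right (hK _) (gaussWeight_pos z).le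

theorem hasDerivAt_heatAvg {W : ℝ × ℝ → ℝ} (hW : IsBoundedSmooth W) (b x T σ : ℝ) :
    HasDerivAt (heatAvg W b x T)
      (-(2 * σ) * ∫ z, (pd2 W (x + b * σ * z, T - σ ^ 2)
        - b ^ 2 / 2 * pd1 (pd1 W) (x + b * σ * z, T - σ ^ 2)) * gaussWeight z) σ := by
  obtain ⟨K, hK⟩ := hW.bounded
  have hK0 : 0 ≤ K := (abs_nonneg _).trans (hK 0).1
  have hc := hW.contDiff.continuous
  have hc1 := hW.contDiff.pd1.continuous
  have hc2 := hW.contDiff.pd2.continuous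
  have hc11 := hW.contDiff.pd1.pd1.continuous
  have hcurve : ∀ s z, HasDerivAt (fun s => W (x + b * s * z, T - s ^ 2) * gaussWeight z)
      ((b * z * pd1 W (x + b * s * z, T - s ^ 2)
        - 2 * s * pd2 W (x + b * s * z, T - s ^ 2)) * gaussWeight z) s := by
    intro s z
    have h1 : HasDerivAt (fun s : ℝ => (x + b * s * z, T - s ^ 2)) (b * z, -(2 * s)) s := by
      refine HasDerivAt.prodMk ?_ ?_
      · have := (((hasDerivAt_id s).const_mul b).mul_const z).const_add x
        simpa using this
      · simpa using (hasDerivAt_pow 2 s).const_sub T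
    have h2 := HasFDerivAt.comp_hasDerivAt s (f := fun s : ℝ => (x + b * s * z, T - s ^ 2))
      (hW.differentiable _).hasFDerivAt h1
    rw [(hW.differentiable _).fderiv_apply_eq_pd] at h2
    refine (h2.mul_const (gaussWeight z)).congr_deriv ?_
    ring
  have key := (hasDerivAt_integral_of_dominated_loc_of_deriv_le (μ := volume)
    (F := fun s z => W (x + b * s * z, T - s ^ 2) * gaussWeight z)
    (F' := fun s z => (b * z * pd1 W (x + b * s * z, T - s ^ 2)
        - 2 * s * pd2 W (x + b * s * z, T - s ^ 2)) * gaussWeight z)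
    (x₀ := σ) (s := Metric.ball σ 1)
    (bound := fun z => |b| * K * (|z| * |gaussWeight z|) + 2 * (|σ| + 1) * K * gaussWeight z)
    (Metric.ball_mem_nhds σ one_pos)
    (Filter.Eventually.of_forall fun s => (integrable_heatAvg hc (fun p => (hK p).1) b x T s).1)
    (integrable_heatAvg hc (fun p => (hK p).1) b x T σ)
    (by
      refine Continuous.aestronglyMeasurable ?_
      have := continuous_gaussWeight
      fun_prop)
    (Filter.Eventually.of_forall fun z s hs => ?_)
    (((integrable_abs_mul integrable_mul_gaussWeight).const_mul _).add
      (integrable_gaussWeight.const_mul _))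
    (Filter.Eventually.of_forall fun z s _ => hcurve s z)).2
  · refine key.congr_deriv ?_
    have i1 : Integrable fun z => pd1 W (x + b * σ * z, T - σ ^ 2) * (z * gaussWeight z) :=
      Continuous.integrable_mul_of_bound (by fun_prop) (fun z => (hK _).2.1)
        integrable_mul_gaussWeight
    have i2 := integrable_heatAvg hc2 (fun p => (hK p).2.2.1) b x T σ
    have i3 := integrable_heatAvg hc11 (fun p => (hK p).2.2.2) b x T σ
    have ibp := mul_integral_deriv_comp_affine (H := fun y => pd1 W (y, T - σ ^ 2))
      (H' := fun y => pd1 (pd1 W) (y, T - σ ^ 2))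
      (fun y => (hW.contDiff.pd1.differentiable (by simp) _).hasDerivAt_pd1)
      (by fun_prop) (fun y => (hK _).2.1) (fun y => (hK _).2.2.2) hasDerivAt_gaussWeight
      integrable_gaussWeight integrable_mul_gaussWeight x (b * σ)
    calc _ = ∫ z, (b * (pd1 W (x + b * σ * z, T - σ ^ 2) * (z * gaussWeight z))
          - 2 * σ * (pd2 W (x + b * σ * z, T - σ ^ 2) * gaussWeight z)) := by
          congr 1; ext z; ring
      _ = b * (b * σ * ∫ z, pd1 (pd1 W) (x + b * σ * z, T - σ ^ 2) * gaussWeight z)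
          - 2 * σ * ∫ z, pd2 W (x + b * σ * z, T - σ ^ 2) * gaussWeight z := by
          rw [integral_sub (i1.const_mul _) (i2.const_mul _), integral_const_mul,
            integral_const_mul, ibp]
      _ = -(2 * σ) * ∫ z, (pd2 W (x + b * σ * z, T - σ ^ 2) * gaussWeight z
          - b ^ 2 / 2 * (pd1 (pd1 W) (x + b * σ * z, T - σ ^ 2) * gaussWeight z)) := by
          rw [integral_sub i2 (i3.const_mul _), integral_const_mul]; ring
      _ = _ := by
          congr 2; ext z; ring
  · have hs' : |s| ≤ |σ| + 1 := by
      have h := (Metric.mem_ball.1 hs).le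
      rw [Real.dist_eq] at h
      have := abs_sub_abs_le_abs_sub s σ
      linarith
    rw [Real.norm_eq_abs, abs_mul, abs_of_pos (gaussWeight_pos z)]
    have h1 : |b * z * pd1 W (x + b * s * z, T - s ^ 2)| ≤ |b| * |z| * K := by
      rw [abs_mul, abs_mul]
      exact mul_le_mul_of_nonneg_left (hK _).2.1 (by positivity)
    have h2 : |2 * s * pd2 W (x + b * s * z, T - s ^ 2)| ≤ 2 * (|σ| + 1) * K := by
      rw [abs_mul, abs_mul, abs_two]
      have := (hK (x + b * s * z, T - s ^ 2)).2.2.1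
      gcongr
    have h3 := abs_sub (b * z * pd1 W (x + b * s * z, T - s ^ 2))
      (2 * s * pd2 W (x + b * s * z, T - s ^ 2))
    calc _ ≤ (|b| * |z| * K + 2 * (|σ| + 1) * K) * gaussWeight z :=
          mul_le_mul_of_nonneg_right (by linarith) (gaussWeight_pos z).le
      _ = _ := by ring

theorem hasDerivAt_heatAvg_space {W : ℝ × ℝ → ℝ} (hW : IsBoundedSmooth W) (b x T σ : ℝ) :
    HasDerivAt (fun y => heatAvg W b y T σ) (heatAvg (pd1 W) b x T σ) x := by
  obtain ⟨K, hK⟩ := hW.bounded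
  have hc := hW.contDiff.continuous
  have hc1 := hW.contDiff.pd1.continuous
  refine (hasDerivAt_integral_of_dominated_loc_of_deriv_le (μ := volume)
    (F := fun y z => W (y + b * σ * z, T - σ ^ 2) * gaussWeight z)
    (F' := fun y z => pd1 W (y + b * σ * z, T - σ ^ 2) * gaussWeight z)
    (x₀ := x) (s := Set.univ)
    (bound := fun z => K * gaussWeight z) Filter.univ_mem
    (Filter.Eventually.of_forall fun y => (integrable_heatAvg hc (fun p => (hK p).1) b y T σ).1)
    (integrable_heatAvg hc (fun p => (hK p).1) b x T σ)
    (integrable_heatAvg hc1 (fun p => (hK p).2.1) b x T σ).1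
    (Filter.Eventually.of_forall fun z y _ => ?_)
    (integrable_gaussWeight.const_mul _)
    (Filter.Eventually.of_forall fun z y _ => ?_)).2
  · rw [Real.norm_eq_abs, abs_mul, abs_of_pos (gaussWeight_pos z)]
    exact mul_le_mul_of_nonneg_right (hK _).2.1 (gaussWeight_pos z).le
  · refine HasDerivAt.mul_const ?_ _
    exact ((hW.differentiable _).hasDerivAt_pd1 (s := y + b * σ * z)).comp_add_const y (b * σ * z)

theorem abs_sub_le_of_abs_deriv_le {f f' B B' : ℝ → ℝ} {R : ℝ} (hR : 0 ≤ R)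
    (hf : ContinuousOn f (Set.Icc 0 R)) (hB : ContinuousOn B (Set.Icc 0 R))
    (hf' : ∀ s, 0 < s → HasDerivAt f (f' s) s) (hB' : ∀ s, 0 < s → HasDerivAt B (B' s) s)
    (hle : ∀ s, 0 < s → |f' s| ≤ B' s) : |f R - f 0| ≤ B R - B 0 := by
  have h0 : (0 : ℝ) ∈ Set.Icc 0 R := ⟨le_rfl, hR⟩
  have h1 : R ∈ Set.Icc 0 R := ⟨hR, le_rfl⟩
  have m1 : MonotoneOn (fun s => B s - f s) (Set.Icc 0 R) := by
    refine monotoneOn_of_deriv_nonneg (convex_Icc 0 R) (hB.sub hf) ?_ ?_ <;>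
      rw [interior_Icc]
    · exact fun s hs => ((hB' s hs.1).sub (hf' s hs.1)).differentiableAt.differentiableWithinAt
    · intro s hs
      have := ((hB' s hs.1).sub (hf' s hs.1)).deriv
      erw [this]
      linarith [(abs_le.1 (hle s hs.1)).2]
  have m2 : MonotoneOn (fun s => B s + f s) (Set.Icc 0 R) := by
    refine monotoneOn_of_deriv_nonneg (convex_Icc 0 R) (hB.add hf) ?_ ?_ <;>
      rw [interior_Icc]
    · exact fun s hs => ((hB' s hs.1).add (hf' s hs.1)).differentiableAt.differentiableWithinAt
    · intro s hs
      have := ((hB' s hs.1).add (hf' s hs.1)).deriv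
      erw [this]
      linarith [(abs_le.1 (hle s hs.1)).1]
  have := m1 h0 h1 hR
  have := m2 h0 h1 hR
  simp only at *
  exact abs_le.2 ⟨by linarith, by linarith⟩

theorem abs_sub_heatAvg_le {α b₀ b : ℝ} (hα : 0 < α) (hα1 : α < 1) (hb₀ : 0 < b₀) (hb : b₀ ≤ b)
    {W F g : ℝ × ℝ → ℝ} (hW : IsBoundedSmooth W) (hF : IsBoundedSmooth F) (hg : Continuous g)
    {A G : ℝ} (hA : 0 ≤ A) (hG : ∀ p, |g p| ≤ G)
    (hHol : ∀ x y t, |F (x, t) - F (y, t)| ≤ A * |x - y| ^ α)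
    (heq : ∀ p, pd2 W p - b ^ 2 / 2 * pd1 (pd1 W) p + W p = pd1 (pd1 F) p + g p)
    (x T : ℝ) {R : ℝ} (hR : 0 ≤ R) :
    |(∫ z, gaussWeight z) * W (x, T) - Real.exp (-R ^ 2) * heatAvg W b x T R|
      ≤ 2 * b₀ ^ (α - 2) * (∫ z, (1 + |z|) * |(z ^ 2 - 1) * gaussWeight z|) / α * A * R ^ α
        + (∫ z, gaussWeight z) * G * R ^ 2 := by
  set M := ∫ z, (1 + |z|) * |(z ^ 2 - 1) * gaussWeight z| with hM
  set Z := ∫ z, gaussWeight z with hZ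
  have hM0 : 0 ≤ M := integral_nonneg fun z => by positivity
  obtain ⟨K, hK⟩ := hW.bounded
  obtain ⟨K', hK'⟩ := hF.bounded
  have hbpos : 0 < b := hb₀.trans_le hb
  have hd : ∀ s, HasDerivAt (fun s => Real.exp (-s ^ 2) * heatAvg W b x T s)
      (-(2 * s) * Real.exp (-s ^ 2) * (heatAvg (pd1 (pd1 F)) b x T s + heatAvg g b x T s)) s := by
    intro s
    have h1 : HasDerivAt (fun s : ℝ => Real.exp (-s ^ 2)) (Real.exp (-s ^ 2) * (-(2 * s))) s := by
      exact HasDerivAt.exp ((hasDerivAt_pow 2 s).neg.congr_deriv (by simp))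
    refine (h1.mul (hasDerivAt_heatAvg hW b x T s)).congr_deriv ?_
    have e : heatAvg (pd1 (pd1 F)) b x T s + heatAvg g b x T s
        = heatAvg W b x T s + ∫ z, (pd2 W (x + b * s * z, T - s ^ 2)
        - b ^ 2 / 2 * pd1 (pd1 W) (x + b * s * z, T - s ^ 2)) * gaussWeight z := by
      have i1 := integrable_heatAvg hF.contDiff.pd1.pd1.continuous (fun p => (hK' p).2.2.2) b x T s
      have i2 := integrable_heatAvg hg hG b x T s
      have i3 := integrable_heatAvg hW.contDiff.continuous (fun p => (hK p).1) b x T s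
      have i4 := integrable_heatAvg hW.contDiff.pd2.continuous (fun p => (hK p).2.2.1) b x T s
      have i5 := integrable_heatAvg hW.contDiff.pd1.pd1.continuous
        (fun p => (hK p).2.2.2) b x T s
      have i6 : Integrable fun z => (pd2 W (x + b * s * z, T - s ^ 2)
        - b ^ 2 / 2 * pd1 (pd1 W) (x + b * s * z, T - s ^ 2)) * gaussWeight z := by
        refine (i4.sub (i5.const_mul (b ^ 2 / 2))).congr (Filter.Eventually.of_forall fun z => ?_)
        simp only [Pi.sub_apply]; ring
      unfold heatAvg
      rw [← integral_add i1 i2, ← integral_add i3 i6]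
      congr 1; ext z
      rw [← add_mul, ← add_mul, ← heq]; ring
    rw [e]; ring
  have hB : ∀ s, 0 < s → HasDerivAt
      (fun s => 2 * b₀ ^ (α - 2) * M / α * A * s ^ α + Z * G * s ^ 2)
      (2 * b₀ ^ (α - 2) * M * A * s ^ (α - 1) + Z * G * (2 * s)) s := by
    intro s hs
    refine (((Real.hasDerivAt_rpow_const (Or.inl hs.ne')).const_mul _).add
      ((hasDerivAt_pow 2 s).const_mul (Z * G))).congr_deriv ?_
    field_simp
    simp
    ring
  have hBc : Continuous fun s : ℝ => 2 * b₀ ^ (α - 2) * M / α * A * s ^ α + Z * G * s ^ 2 := by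
    have : Continuous fun s : ℝ => s ^ α := Real.continuous_rpow_const hα.le
    fun_prop
  have hle : ∀ s, 0 < s →
      |-(2 * s) * Real.exp (-s ^ 2) * (heatAvg (pd1 (pd1 F)) b x T s + heatAvg g b x T s)|
        ≤ 2 * b₀ ^ (α - 2) * M * A * s ^ (α - 1) + Z * G * (2 * s) := by
    intro s hs
    have h1 := sq_mul_abs_integral_deriv_deriv_le (H := fun y => F (y, T - s ^ 2))
      (H' := fun y => pd1 F (y, T - s ^ 2)) (H'' := fun y => pd1 (pd1 F) (y, T - s ^ 2))
      (fun y => (hF.differentiable _).hasDerivAt_pd1)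
      (fun y => (hF.contDiff.pd1.differentiable (by simp) _).hasDerivAt_pd1)
      (by have := hF.contDiff.pd1.pd1.continuous
          fun_prop)
      (fun y => (hK' _).1) (fun y => (hK' _).2.1) (fun y => (hK' _).2.2.2)
      hα.le hα1.le (r := b * s) (by positivity) hA (fun y y' => hHol y y' _) x
    change (b * s) ^ 2 * |heatAvg (pd1 (pd1 F)) b x T s| ≤ A * (b * s) ^ α * M at h1
    have h2 : |heatAvg (pd1 (pd1 F)) b x T s| ≤ A * (b * s) ^ (α - 2) * M := by
      rw [Real.rpow_sub (by positivity), Real.rpow_two]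
      rw [← le_div_iff₀' (by positivity)] at h1
      refine h1.trans (le_of_eq ?_)
      ring
    have h3 : |heatAvg (pd1 (pd1 F)) b x T s| ≤ A * (b₀ ^ (α - 2) * s ^ (α - 2)) * M := by
      refine h2.trans ?_
      rw [Real.mul_rpow hbpos.le hs.le]
      have := Real.rpow_le_rpow_of_nonpos hb₀ hb (by linarith : α - 2 ≤ 0)
      have := Real.rpow_nonneg hs.le (α - 2)
      gcongr
    have h4 := abs_heatAvg_le hG b x T s
    have h5 := abs_add_le (heatAvg (pd1 (pd1 F)) b x T s) (heatAvg g b x T s)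
    have h6 : Real.exp (-s ^ 2) ≤ 1 := by
      rw [Real.exp_le_one_iff]; nlinarith [sq_nonneg s]
    have h7 : s ^ (α - 1) = s * s ^ (α - 2) := by
      rw [show α - 1 = 1 + (α - 2) by ring, Real.rpow_add hs, Real.rpow_one]
    rw [abs_mul, abs_mul, abs_neg, abs_of_pos (by positivity : 0 < 2 * s), Real.abs_exp]
    calc _ ≤ 2 * s * 1 * (A * (b₀ ^ (α - 2) * s ^ (α - 2)) * M + G * Z) := by
          gcongr
          linarith
      _ = _ := by rw [h7]; ring
  have hfc : Continuous fun s => Real.exp (-s ^ 2) * heatAvg W b x T s :=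
    continuous_iff_continuousAt.2 fun s => (hd s).continuousAt
  have key := abs_sub_le_of_abs_deriv_le hR hfc.continuousOn hBc.continuousOn
    (fun s _ => hd s) hB hle
  rw [abs_sub_comm] at key
  simpa [heatAvg_zero, Real.zero_rpow hα.ne'] using key

/-! ### The estimate for smooth bounded solutions -/

theorem le_of_forall_half_step {ι : Type*} {a w : ι → ℝ} {D : ℝ}
    (h0 : ∃ K, ∀ i, a i ≤ K * w i)
    (hstep : ∀ K, (∀ i, a i ≤ K * w i) → ∀ i, a i ≤ (K / 2 + D) * w i) (i : ι) :
    a i ≤ 2 * D * w i := by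
  obtain ⟨K, hK⟩ := h0
  have h : ∀ n : ℕ, ∀ i, a i ≤ ((K - 2 * D) * (1 / 2) ^ n + 2 * D) * w i := by
    intro n
    induction n with
    | zero => simpa using hK
    | succ n ih =>
      intro i
      refine (hstep _ ih i).trans (le_of_eq ?_)
      rw [pow_succ]; ring
  have hl : Filter.Tendsto (fun n : ℕ => ((K - 2 * D) * (1 / 2) ^ n + 2 * D) * w i) Filter.atTop
      (nhds (((K - 2 * D) * 0 + 2 * D) * w i)) :=
    (((tendsto_pow_atTop_nhds_zero_of_lt_one (by norm_num) (by norm_num)).const_mul _).add_const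
      _).mul_const _
  have := ge_of_tendsto' hl fun n => h n i
  simpa using this

theorem integral_gaussWeight_pos : 0 < ∫ z, gaussWeight z :=
  integral_pos_of_integrable_nonneg_nonzero (x := 0) continuous_gaussWeight
    integrable_gaussWeight (fun z => (gaussWeight_pos z).le) (gaussWeight_pos 0).ne'

theorem abs_le_of_heat_equation {α b₀ b : ℝ} (hα : 0 < α) (hα1 : α < 1) (hb₀ : 0 < b₀)
    (hb : b₀ ≤ b) {c Z : ℝ}
    (hc : c = 2 * b₀ ^ (α - 2) * (∫ z, (1 + |z|) * |(z ^ 2 - 1) * gaussWeight z|) / α)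
    (hZ : Z = ∫ z, gaussWeight z)
    {W F g : ℝ × ℝ → ℝ} (hW : IsBoundedSmooth W) (hF : IsBoundedSmooth F) (hg : Continuous g)
    {A G : ℝ} (hA : 0 ≤ A) (hG : ∀ p, |g p| ≤ G)
    (hHol : ∀ x y t, |F (x, t) - F (y, t)| ≤ A * |x - y| ^ α)
    (heq : ∀ p, pd2 W p - b ^ 2 / 2 * pd1 (pd1 W) p + W p = pd1 (pd1 F) p + g p) (p : ℝ × ℝ) :
    |W p| ≤ 2 * ((c * A + Z * G) / Z) := by
  have hZ0 : 0 < Z := hZ ▸ integral_gaussWeight_pos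
  have := le_of_forall_half_step (a := fun p => |W p|) (w := fun _ => 1)
    (D := (c * A + Z * G) / Z) (by
      obtain ⟨K, hK⟩ := hW.bounded
      exact ⟨K, fun p => by simpa using (hK p).1⟩) ?_ p
  · simpa using this
  intro K hK p
  simp only [mul_one] at hK ⊢
  have hK0 : 0 ≤ K := (abs_nonneg _).trans (hK p)
  have h1 := abs_sub_heatAvg_le hα hα1 hb₀ hb hW hF hg hA hG hHol heq p.1 p.2 zero_le_one
  have h2 := abs_heatAvg_le hK b p.1 p.2 1
  rw [← hc, ← hZ] at h1
  rw [← hZ] at h2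
  have h3 : Real.exp (-1 ^ 2) ≤ 1 / 2 := by
    rw [one_pow, Real.exp_neg, one_div]
    exact inv_anti₀ (by norm_num) (by linarith [Real.add_one_le_exp 1])
  have h4 : |Real.exp (-1 ^ 2) * heatAvg W b p.1 p.2 1| ≤ 1 / 2 * (K * Z) := by
    rw [abs_mul, Real.abs_exp]
    gcongr
  have h5 : Z * |W p| = |Z * W p| := by rw [abs_mul, abs_of_pos hZ0]
  have h6 := abs_sub_abs_le_abs_sub (Z * W p) (Real.exp (-1 ^ 2) * heatAvg W b p.1 p.2 1)
  simp only [Real.one_rpow, one_pow, mul_one] at h1 h4 h6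
  have h7 : Z * |W p| ≤ K / 2 * Z + (c * A + Z * G) := by rw [h5]; linarith
  rw [← sub_le_iff_le_add', le_div_iff₀ hZ0]
  linarith

theorem space_holder_of_heat_equation {α b₀ : ℝ} (hα : 0 < α) (hα1 : α < 1) (hb₀ : 0 < b₀) :
    ∃ D : ℝ, 0 ≤ D ∧ ∀ b, b₀ ≤ b → ∀ W F g : ℝ × ℝ → ℝ,
      IsBoundedSmooth W → IsBoundedSmooth F → Continuous g →
      ∀ A G : ℝ, 0 ≤ A → (∀ p, |g p| ≤ G) →
      (∀ x y t, |F (x, t) - F (y, t)| ≤ A * |x - y| ^ α) →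
      (∃ K, ∀ x y t, |W (x, t) - W (y, t)| ≤ K * |x - y| ^ α) →
      (∀ p, pd2 W p - b ^ 2 / 2 * pd1 (pd1 W) p + W p = pd1 (pd1 F) p + g p) →
      (∀ p, |W p| ≤ D * (A + G)) ∧
        ∀ x y t, |W (x, t) - W (y, t)| ≤ D * (A + G) * |x - y| ^ α := by
  obtain ⟨c, hc⟩ : ∃ c, c = 2 * b₀ ^ (α - 2) *
    (∫ z, (1 + |z|) * |(z ^ 2 - 1) * gaussWeight z|) / α := ⟨_, rfl⟩
  obtain ⟨Z, hZ⟩ : ∃ Z, Z = ∫ z, gaussWeight z := ⟨_, rfl⟩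
  obtain ⟨M, hM⟩ : ∃ M, M = ∫ z, (1 + |z|) * |z * gaussWeight z| := ⟨_, rfl⟩
  have hc0 : 0 ≤ c := by
    rw [hc]
    have : 0 ≤ ∫ z : ℝ, (1 + |z|) * |(z ^ 2 - 1) * gaussWeight z| :=
      integral_nonneg fun z => by positivity
    positivity
  have hM0 : 0 ≤ M := hM ▸ integral_nonneg fun z => by positivity
  have hZ0 : 0 < Z := hZ ▸ integral_gaussWeight_pos
  obtain ⟨k, hk0, hk⟩ : ∃ k : ℝ, 0 < k ∧ (b₀ * k) ^ (α - 1) * M ≤ Z / 2 := by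
    have h1 : Filter.Tendsto (fun k : ℝ => (b₀ * k) ^ (α - 1) * M) Filter.atTop (nhds (0 * M)) := by
      refine Filter.Tendsto.mul_const _ ?_
      have := (tendsto_rpow_neg_atTop (by linarith : 0 < 1 - α)).comp
        (Filter.tendsto_id.const_mul_atTop hb₀)
      simpa [Function.comp_def] using this
    rw [zero_mul] at h1
    obtain ⟨k, h2, h3⟩ := ((h1.eventually (gt_mem_nhds (half_pos hZ0))).and
      (Filter.eventually_gt_atTop 0)).exists
    exact ⟨k, h3, h2.le⟩
  set d₁ := 2 * ((c + Z) / Z) with hd₁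
  have hd₁0 : 0 ≤ d₁ := by positivity
  set d₂ := 2 * (c * k ^ α + Z * k ^ 2) / Z + 2 * d₁ with hd₂
  have hd₂0 : 0 ≤ d₂ := by positivity
  refine ⟨d₁ + 2 * d₂, by positivity, ?_⟩
  intro b hb W F g hW hF hg A G hA hG hHol hWHol heq
  have hG0 : 0 ≤ G := (abs_nonneg _).trans (hG 0)
  have hbpos : 0 < b := hb₀.trans_le hb
  have hsup : ∀ p, |W p| ≤ d₁ * (A + G) := fun p => by
    refine (abs_le_of_heat_equation hα hα1 hb₀ hb hc hZ hW hF hg hA hG hHol heq p).trans ?_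
    rw [hd₁, mul_assoc, div_mul_eq_mul_div]
    gcongr
    nlinarith [mul_nonneg hc0 hG0, mul_nonneg hZ0.le hA]
  obtain ⟨K₁, hK₁⟩ := hW.bounded
  have hstep := le_of_forall_half_step (ι := ℝ × ℝ × ℝ)
    (a := fun i => |W (i.1, i.2.2) - W (i.2.1, i.2.2)|)
    (w := fun i => |i.1 - i.2.1| ^ α) (D := d₂ * (A + G))
    (hWHol.imp fun K hK i => hK _ _ _) ?_
  · refine ⟨fun p => (hsup p).trans ?_, fun x y t => (hstep (x, y, t)).trans ?_⟩
    · gcongr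
      linarith
    · have : 0 ≤ d₁ * ((A + G) * |x - y| ^ α) := by positivity
      simp only
      linarith
  rintro K hK ⟨x, y, t⟩
  have hK0 : 0 ≤ K := by
    have := (abs_nonneg _).trans (hK (0, 1, 0))
    simpa using this
  simp only
  rcases eq_or_ne x y with rfl | hxy
  · simp [Real.zero_rpow hα.ne']
  have hh : 0 < |x - y| := abs_pos.2 (sub_ne_zero.2 hxy)
  set h := |x - y| with hh'
  rcases le_or_gt h 1 with h1 | h1
  · have hR : 0 < k * h := by positivity
    have e1 := abs_sub_heatAvg_le hα hα1 hb₀ hb hW hF hg hA hG hHol heq x t hR.le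
    have e2 := abs_sub_heatAvg_le hα hα1 hb₀ hb hW hF hg hA hG hHol heq y t hR.le
    rw [← hc, ← hZ] at e1 e2
    have e3 : |heatAvg W b x t (k * h) - heatAvg W b y t (k * h)| ≤ K / 2 * Z * h ^ α := by
      have hder : ∀ u, |heatAvg (pd1 W) b u t (k * h)| ≤ K * (b * (k * h)) ^ (α - 1) * M := by
        intro u
        have := mul_abs_integral_deriv_le (H := fun y => W (y, t - (k * h) ^ 2))
          (H' := fun y => pd1 W (y, t - (k * h) ^ 2))
          (fun y => (hW.differentiable _).hasDerivAt_pd1)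
          (by have := hW.contDiff.pd1.continuous
              fun_prop)
          (fun y => (hK₁ _).1) (fun y => (hK₁ _).2.1) hα.le hα1.le (r := b * (k * h))
          (by positivity) hK0 (fun y y' => hK (y, y', _)) u
        rw [← hM, ← le_div_iff₀' (by positivity)] at this
        refine this.trans (le_of_eq ?_)
        rw [Real.rpow_sub (by positivity), Real.rpow_one]
        ring
      have mvt := Convex.norm_image_sub_le_of_norm_hasDerivWithin_le (s := Set.univ)
        (fun u _ => (hasDerivAt_heatAvg_space hW b u t (k * h)).hasDerivWithinAt)
        (fun u _ => hder u) convex_univ (Set.mem_univ y) (Set.mem_univ x)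
      rw [Real.norm_eq_abs, Real.norm_eq_abs, ← hh'] at mvt
      refine mvt.trans ?_
      have e4 : (b * (k * h)) ^ (α - 1) = (b * k) ^ (α - 1) * h ^ (α - 1) := by
        rw [← mul_assoc, Real.mul_rpow (by positivity) hh.le]
      have e5 : (b * k) ^ (α - 1) ≤ (b₀ * k) ^ (α - 1) :=
        Real.rpow_le_rpow_of_nonpos (by positivity) (by gcongr) (by linarith)
      have e6 : h ^ (α - 1) * h = h ^ α := by
        rw [← Real.rpow_add_one hh.ne']; congr 1; ring
      have e7 : (b * k) ^ (α - 1) * M ≤ Z / 2 :=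
        (mul_le_mul_of_nonneg_right e5 hM0).trans hk
      calc K * (b * (k * h)) ^ (α - 1) * M * h
          = K * ((b * k) ^ (α - 1) * M) * (h ^ (α - 1) * h) := by rw [e4]; ring
        _ ≤ K * (Z / 2) * h ^ α := by rw [e6]; gcongr
        _ = _ := by ring
    have e4 : |Real.exp (-(k * h) ^ 2) * heatAvg W b x t (k * h)
        - Real.exp (-(k * h) ^ 2) * heatAvg W b y t (k * h)| ≤ K / 2 * Z * h ^ α := by
      rw [← mul_sub, abs_mul, Real.abs_exp]
      have : Real.exp (-(k * h) ^ 2) ≤ 1 := by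
        rw [Real.exp_le_one_iff]; nlinarith [sq_nonneg (k * h)]
      exact (mul_le_of_le_one_left (abs_nonneg _) this).trans e3
    have e5 : h ^ 2 ≤ h ^ α := by
      rw [← Real.rpow_two]
      exact Real.rpow_le_rpow_of_exponent_ge hh h1 (by linarith)
    have e6 : Z * |W (x, t) - W (y, t)| = |Z * W (x, t) - Z * W (y, t)| := by
      rw [← mul_sub, abs_mul, abs_of_pos hZ0]
    have e7 : c * A * (k * h) ^ α + Z * G * (k * h) ^ 2
        ≤ (c * k ^ α + Z * k ^ 2) * (A + G) * h ^ α := by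
      rw [Real.mul_rpow hk0.le hh.le, mul_pow]
      have : Z * G * (k ^ 2 * h ^ 2) ≤ Z * G * (k ^ 2 * h ^ α) := by gcongr
      have p1 : 0 ≤ c * k ^ α * G * h ^ α := by positivity
      have p2 : 0 ≤ Z * k ^ 2 * A * h ^ α := by positivity
      nlinarith
    have e8 : Z * |W (x, t) - W (y, t)|
        ≤ 2 * ((c * k ^ α + Z * k ^ 2) * (A + G) * h ^ α) + K / 2 * Z * h ^ α := by
      rw [e6]
      rw [abs_le] at e1 e2 e4 ⊢
      constructor <;> linarith [e1.1, e1.2, e2.1, e2.2, e4.1, e4.2]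
    have e9 : |W (x, t) - W (y, t)|
        ≤ (2 * ((c * k ^ α + Z * k ^ 2) * (A + G) * h ^ α) + K / 2 * Z * h ^ α) / Z := by
      rwa [le_div_iff₀' hZ0]
    refine e9.trans ?_
    have e10 : (2 * ((c * k ^ α + Z * k ^ 2) * (A + G) * h ^ α) + K / 2 * Z * h ^ α) / Z
        = (K / 2 + 2 * (c * k ^ α + Z * k ^ 2) / Z * (A + G)) * h ^ α := by
      field_simp; ring
    rw [e10, hd₂]
    gcongr
    linarith
  · have e1 : (1 : ℝ) ≤ h ^ α := Real.one_le_rpow h1.le hα.le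
    have e2 := abs_sub (W (x, t)) (W (y, t))
    have e3 : 2 * (d₁ * (A + G)) ≤ d₂ * (A + G) := by
      rw [← mul_assoc]
      gcongr
      rw [hd₂]
      have : 0 ≤ 2 * (c * k ^ α + Z * k ^ 2) / Z := by positivity
      linarith
    calc _ ≤ 2 * (d₁ * (A + G)) := by linarith [hsup (x, t), hsup (y, t)]
      _ ≤ (K / 2 + d₂ * (A + G)) * 1 := by linarith
      _ ≤ _ := by gcongr

theorem schauder_of_heat_equation {α b₀ : ℝ} (hα : 0 < α) (hα1 : α < 1) (hb₀ : 0 < b₀) :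
    ∃ D : ℝ, 0 ≤ D ∧ ∀ b, b₀ ≤ b → b ≤ 2 → ∀ W F g : ℝ × ℝ → ℝ,
      IsBoundedSmooth W → IsBoundedSmooth F → Continuous g →
      ∀ A G : ℝ, 0 ≤ A → (∀ p, |g p| ≤ G) →
      (∀ x y t, |F (x, t) - F (y, t)| ≤ A * |x - y| ^ α) →
      (∃ K, ∀ x y t, |W (x, t) - W (y, t)| ≤ K * |x - y| ^ α) →
      (∀ p, pd2 W p - b ^ 2 / 2 * pd1 (pd1 W) p + W p = pd1 (pd1 F) p + g p) →
      (∀ p, |W p| ≤ D * (A + G)) ∧ ∀ p q, |W p - W q| ≤ D * (A + G) * pdist p q ^ α := by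
  obtain ⟨d, hd0, hd⟩ := space_holder_of_heat_equation hα hα1 hb₀
  obtain ⟨c, hc⟩ : ∃ c, c = 2 * b₀ ^ (α - 2) *
    (∫ z, (1 + |z|) * |(z ^ 2 - 1) * gaussWeight z|) / α := ⟨_, rfl⟩
  obtain ⟨Z, hZ⟩ : ∃ Z, Z = ∫ z, gaussWeight z := ⟨_, rfl⟩
  obtain ⟨M, hM⟩ : ∃ M, M = ∫ z, (1 + |z|) * |gaussWeight z| := ⟨_, rfl⟩
  have hc0 : 0 ≤ c := by
    rw [hc]
    have : 0 ≤ ∫ z : ℝ, (1 + |z|) * |(z ^ 2 - 1) * gaussWeight z| :=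
      integral_nonneg fun z => by positivity
    positivity
  have hM0 : 0 ≤ M := hM ▸ integral_nonneg fun z => by positivity
  have hZ0 : 0 < Z := hZ ▸ integral_gaussWeight_pos
  set e := (c + Z + 2 * d * M + Z * d) / Z + 2 * d with he
  have he0 : 0 ≤ e := by positivity
  refine ⟨d + e, by positivity, ?_⟩
  intro b hb hb2 W F g hW hF hg A G hA hG hHol hWHol heq
  obtain ⟨hsup, hspace⟩ := hd b hb W F g hW hF hg A G hA hG hHol hWHol heq
  have hG0 : 0 ≤ G := (abs_nonneg _).trans (hG 0)
  have hS0 : 0 ≤ A + G := by positivity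
  have hbpos : 0 < b := hb₀.trans_le hb
  obtain ⟨K, hK⟩ := hW.bounded
  have htime' : ∀ x T R, 0 ≤ R →
      |W (x, T) - W (x, T - R ^ 2)| ≤ e * (A + G) * R ^ α := by
    intro x T R hR
    rcases hR.eq_or_lt with rfl | hRpos
    · simp [Real.zero_rpow hα.ne']
    rcases le_or_gt R 1 with h1 | h1
    · have e1 := abs_sub_heatAvg_le hα hα1 hb₀ hb hW hF hg hA hG hHol heq x T hR
      rw [← hc, ← hZ] at e1
      have e2 : |heatAvg W b x T R - Z * W (x, T - R ^ 2)|
          ≤ d * (A + G) * (b * R) ^ α * M := by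
        have h3 := abs_integral_sub_mul_le (H := fun y => W (y, T - R ^ 2)) (q := gaussWeight)
          (c := W (x, T - R ^ 2)) (x := x) (r := b * R) hα.le hα1.le (by positivity)
          (by positivity : 0 ≤ d * (A + G))
          (fun z => by simpa using hspace (x + b * R * z) x (T - R ^ 2)) integrable_gaussWeight
          integrable_mul_gaussWeight
        rw [← hM] at h3
        have h4 : ∫ z, (W (x + b * R * z, T - R ^ 2) - W (x, T - R ^ 2)) * gaussWeight z
            = heatAvg W b x T R - Z * W (x, T - R ^ 2) := by
          simp only [sub_mul]
          rw [integral_sub (integrable_heatAvg hW.contDiff.continuous (fun p => (hK p).1) b x T R)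
            (integrable_gaussWeight.const_mul _), integral_const_mul, ← hZ, heatAvg]
          ring
        rwa [h4] at h3
      have e3 : (b * R) ^ α ≤ 2 * R ^ α := by
        rw [Real.mul_rpow hbpos.le hR]
        gcongr
        calc b ^ α ≤ 2 ^ α := by gcongr
          _ ≤ 2 ^ (1 : ℝ) := Real.rpow_le_rpow_of_exponent_le (by norm_num) hα1.le
          _ = 2 := Real.rpow_one _
      have e4 : R ^ 2 ≤ R ^ α := by
        rw [← Real.rpow_two]
        exact Real.rpow_le_rpow_of_exponent_ge hRpos h1 (by linarith)
      have x1 : Real.exp (-R ^ 2) ≤ 1 := by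
        rw [Real.exp_le_one_iff]; nlinarith [sq_nonneg R]
      have x2 : 1 - Real.exp (-R ^ 2) ≤ R ^ 2 := by
        linarith [Real.add_one_le_exp (-R ^ 2)]
      have e5 : |Real.exp (-R ^ 2) * heatAvg W b x T R
          - Real.exp (-R ^ 2) * (Z * W (x, T - R ^ 2))| ≤ 2 * d * M * (A + G) * R ^ α := by
        rw [← mul_sub, abs_mul, Real.abs_exp]
        refine (mul_le_of_le_one_left (abs_nonneg _) x1).trans (e2.trans ?_)
        calc _ ≤ d * (A + G) * (2 * R ^ α) * M := by gcongr
          _ = _ := by ring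
      have e6 : |(1 - Real.exp (-R ^ 2)) * (Z * W (x, T - R ^ 2))|
          ≤ Z * d * (A + G) * R ^ α := by
        rw [abs_mul, abs_mul, abs_of_nonneg (by linarith : 0 ≤ 1 - Real.exp (-R ^ 2)),
          abs_of_pos hZ0]
        calc _ ≤ R ^ α * (Z * (d * (A + G))) := by
              gcongr
              · exact x2.trans e4
              · exact hsup _
          _ = _ := by ring
      have e7 : c * A * R ^ α + Z * G * R ^ 2 ≤ (c + Z) * (A + G) * R ^ α := by
        have : Z * G * R ^ 2 ≤ Z * G * R ^ α := by gcongr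
        have p1 : 0 ≤ c * G * R ^ α := by positivity
        have p2 : 0 ≤ Z * A * R ^ α := by positivity
        nlinarith
      have e8 : Z * |W (x, T) - W (x, T - R ^ 2)|
          ≤ (c + Z + 2 * d * M + Z * d) * ((A + G) * R ^ α) := by
        have : Z * |W (x, T) - W (x, T - R ^ 2)| = |Z * W (x, T) - Z * W (x, T - R ^ 2)| := by
          rw [← mul_sub, abs_mul, abs_of_pos hZ0]
        rw [this]
        rw [abs_le] at e1 e5 e6 ⊢
        constructor <;> linarith [e1.1, e1.2, e5.1, e5.2, e6.1, e6.2]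
      rw [← le_div_iff₀' hZ0] at e8
      refine e8.trans ?_
      have : 0 ≤ 2 * d * ((A + G) * R ^ α) := by positivity
      calc _ = (c + Z + 2 * d * M + Z * d) / Z * ((A + G) * R ^ α) := by ring
        _ ≤ e * ((A + G) * R ^ α) := by rw [he]; linarith
        _ = _ := by ring
    · have e1 : (1 : ℝ) ≤ R ^ α := Real.one_le_rpow h1.le hα.le
      have e2 := abs_sub (W (x, T)) (W (x, T - R ^ 2))
      have e3 : 2 * (d * (A + G)) ≤ e * (A + G) := by
        rw [← mul_assoc]
        gcongr
        rw [he]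
        have : 0 ≤ (c + Z + 2 * d * M + Z * d) / Z := by positivity
        linarith
      calc _ ≤ 2 * (d * (A + G)) := by linarith [hsup (x, T), hsup (x, T - R ^ 2)]
        _ ≤ e * (A + G) * 1 := by linarith
        _ ≤ _ := by gcongr
  have htime : ∀ x s t, |W (x, s) - W (x, t)| ≤ e * (A + G) * Real.sqrt |s - t| ^ α := by
    intro x s t
    rcases le_total t s with h | h
    · have := htime' x s (Real.sqrt |s - t|) (Real.sqrt_nonneg _)
      rwa [Real.sq_sqrt (abs_nonneg _), abs_of_nonneg (by linarith : 0 ≤ s - t),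
        sub_sub_cancel, ← abs_of_nonneg (by linarith : 0 ≤ s - t)] at this
    · have := htime' x t (Real.sqrt |s - t|) (Real.sqrt_nonneg _)
      rw [Real.sq_sqrt (abs_nonneg _), abs_of_nonpos (by linarith : s - t ≤ 0), neg_sub,
        sub_sub_cancel] at this
      rwa [abs_sub_comm, abs_sub_comm s t, abs_of_nonneg (by linarith : 0 ≤ t - s)]
  refine ⟨fun p => (hsup p).trans (by gcongr; linarith), fun p q => ?_⟩
  have t1 := hspace p.1 q.1 p.2
  have t2 := htime q.1 p.2 q.2
  have t3 : |p.1 - q.1| ^ α ≤ pdist p q ^ α := by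
    unfold pdist; gcongr; linarith [Real.sqrt_nonneg |p.2 - q.2|]
  have t4 : Real.sqrt |p.2 - q.2| ^ α ≤ pdist p q ^ α := by
    unfold pdist; gcongr; linarith [abs_nonneg (p.1 - q.1)]
  calc |W p - W q| ≤ |W (p.1, p.2) - W (q.1, p.2)| + |W (q.1, p.2) - W (q.1, q.2)| :=
        abs_sub_le _ _ _
    _ ≤ d * (A + G) * |p.1 - q.1| ^ α + e * (A + G) * Real.sqrt |p.2 - q.2| ^ α := add_le_add t1 t2
    _ ≤ d * (A + G) * pdist p q ^ α + e * (A + G) * pdist p q ^ α := by gcongr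
    _ = _ := by ring

/-! ### Mollification -/

/-- Convolution of `f` with the kernel `φ`. -/
noncomputable def mollify (φ f : ℝ × ℝ → ℝ) (x : ℝ × ℝ) : ℝ := ∫ y, f y * φ (x - y)

theorem mollify_eq_convolution (φ f : ℝ × ℝ → ℝ) :
    mollify φ f = convolution φ f (ContinuousLinearMap.lsmul ℝ ℝ) volume := by
  ext x
  rw [convolution_lsmul_swap]
  simp [mollify, mul_comm]

theorem mollify_eq_swap (φ f : ℝ × ℝ → ℝ) (x : ℝ × ℝ) :
    mollify φ f x = ∫ y, φ y * f (x - y) := by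
  rw [mollify_eq_convolution, convolution_lsmul]
  simp

/-- Smooth compactly supported functions on the plane. -/
structure IsTestFunction (φ : ℝ × ℝ → ℝ) : Prop where
  contDiff : ContDiff ℝ (⊤ : ℕ∞) φ
  hasCompactSupport : HasCompactSupport φ

namespace IsTestFunction

variable {φ : ℝ × ℝ → ℝ}

theorem differentiable (hφ : IsTestFunction φ) : Differentiable ℝ φ :=
  hφ.contDiff.differentiable (by simp)

theorem integrable (hφ : IsTestFunction φ) : Integrable φ :=
  hφ.contDiff.continuous.integrable_of_hasCompactSupport hφ.hasCompactSupport

theorem pd1 (hφ : IsTestFunction φ) : IsTestFunction (pd1 φ) := by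
  refine ⟨hφ.contDiff.pd1, ?_⟩
  rw [show _root_.pd1 φ = fun p => fderiv ℝ φ p (1, 0) from
    funext fun p => (hφ.differentiable p).pd1_eq]
  exact hφ.hasCompactSupport.fderiv_apply ℝ (1, 0)

theorem pd2 (hφ : IsTestFunction φ) : IsTestFunction (pd2 φ) := by
  refine ⟨hφ.contDiff.pd2, ?_⟩
  rw [show _root_.pd2 φ = fun p => fderiv ℝ φ p (0, 1) from
    funext fun p => (hφ.differentiable p).pd2_eq]
  exact hφ.hasCompactSupport.fderiv_apply ℝ (0, 1)

theorem const_sub (hφ : IsTestFunction φ) (x : ℝ × ℝ) : IsTestFunction fun y => φ (x - y) := by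
  refine ⟨hφ.contDiff.comp (contDiff_const.sub contDiff_id), ?_⟩
  exact hφ.hasCompactSupport.comp_homeomorph (Homeomorph.subLeft x)

theorem contDiff_mollify (hφ : IsTestFunction φ) {f : ℝ × ℝ → ℝ} (hf : Continuous f) :
    ContDiff ℝ (⊤ : ℕ∞) (mollify φ f) := by
  rw [mollify_eq_convolution]
  exact hφ.hasCompactSupport.contDiff_convolution_left _ hφ.contDiff hf.locallyIntegrable

theorem fderiv_mollify (hφ : IsTestFunction φ) {f : ℝ × ℝ → ℝ} (hf : Continuous f) (x v : ℝ × ℝ) :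
    fderiv ℝ (mollify φ f) x v = mollify (fun y => fderiv ℝ φ y v) f x := by
  have h := hφ.hasCompactSupport.hasFDerivAt_convolution_left (ContinuousLinearMap.lsmul ℝ ℝ)
    (hφ.contDiff.of_le (by simp)) hf.locallyIntegrable (μ := volume) x
  rw [mollify_eq_convolution, h.fderiv, convolution_def, mollify_eq_swap]
  rw [ContinuousLinearMap.integral_apply]
  · simp
  · refine Continuous.integrable_of_hasCompactSupport ?_ ?_
    · have := hφ.contDiff.continuous_fderiv (by simp)
      exact ((ContinuousLinearMap.precompL (ℝ × ℝ)
        (ContinuousLinearMap.lsmul ℝ ℝ)).continuous.comp this).clm_apply (by fun_prop)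
    · refine (hφ.hasCompactSupport.fderiv ℝ).mono fun y hy => ?_
      contrapose! hy
      simp only [Function.mem_support, not_not] at hy ⊢
      simp [hy]

theorem pd1_mollify (hφ : IsTestFunction φ) {f : ℝ × ℝ → ℝ} (hf : Continuous f) :
    _root_.pd1 (mollify φ f) = mollify (_root_.pd1 φ) f := by
  ext x
  rw [((hφ.contDiff_mollify hf).differentiable (by simp) x).pd1_eq, hφ.fderiv_mollify hf]
  congr 1
  exact funext fun p => (hφ.differentiable p).pd1_eq.symm

theorem pd2_mollify (hφ : IsTestFunction φ) {f : ℝ × ℝ → ℝ} (hf : Continuous f) :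
    _root_.pd2 (mollify φ f) = mollify (_root_.pd2 φ) f := by
  ext x
  rw [((hφ.contDiff_mollify hf).differentiable (by simp) x).pd2_eq, hφ.fderiv_mollify hf]
  congr 1
  exact funext fun p => (hφ.differentiable p).pd2_eq.symm

theorem integrable_mollify (hφ : IsTestFunction φ) {f : ℝ × ℝ → ℝ} (hf : Continuous f) (x : ℝ × ℝ) :
    Integrable fun y => f y * φ (x - y) :=
  (hf.mul (hφ.const_sub x).contDiff.continuous).integrable_of_hasCompactSupport
    (hφ.const_sub x).hasCompactSupport.mul_left

theorem mollify_add (hφ : IsTestFunction φ) {f g : ℝ × ℝ → ℝ} (hf : Continuous f)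
    (hg : Continuous g) (x : ℝ × ℝ) :
    mollify φ (fun y => f y + g y) x = mollify φ f x + mollify φ g x := by
  unfold mollify
  rw [← integral_add (hφ.integrable_mollify hf x) (hφ.integrable_mollify hg x)]
  simp only [add_mul]

theorem mollify_sub (hφ : IsTestFunction φ) {f g : ℝ × ℝ → ℝ} (hf : Continuous f)
    (hg : Continuous g) (x : ℝ × ℝ) :
    mollify φ (fun y => f y - g y) x = mollify φ f x - mollify φ g x := by
  unfold mollify
  rw [← integral_sub (hφ.integrable_mollify hf x) (hφ.integrable_mollify hg x)]
  simp only [sub_mul]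

theorem abs_mollify_le (hφ : IsTestFunction φ) {f : ℝ × ℝ → ℝ} {K : ℝ} (hK : ∀ y, |f y| ≤ K)
    (x : ℝ × ℝ) :
    |mollify φ f x| ≤ K * ∫ y, |φ y| := by
  rw [mollify_eq_swap, ← integral_const_mul, ← Real.norm_eq_abs]
  refine norm_integral_le_of_norm_le (hφ.integrable.abs.const_mul K)
    (Filter.Eventually.of_forall fun y => ?_)
  rw [Real.norm_eq_abs, abs_mul, mul_comm]
  exact mul_le_mul_of_nonneg_right (hK _) (abs_nonneg _)

theorem isBoundedSmooth_mollify (hφ : IsTestFunction φ) {f : ℝ × ℝ → ℝ} (hf : Continuous f) {K : ℝ}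
    (hK : ∀ y, |f y| ≤ K) : IsBoundedSmooth (mollify φ f) := by
  refine ⟨hφ.contDiff_mollify hf, ?_⟩
  rw [hφ.pd1_mollify hf, hφ.pd2_mollify hf, hφ.pd1.pd1_mollify hf]
  refine ⟨max (max (K * ∫ y, |φ y|) (K * ∫ y, |_root_.pd1 φ y|))
    (max (K * ∫ y, |_root_.pd2 φ y|) (K * ∫ y, |_root_.pd1 (_root_.pd1 φ) y|)),
    fun p => ⟨?_, ?_, ?_, ?_⟩⟩
  · exact (hφ.abs_mollify_le hK p).trans ((le_max_left _ _).trans (le_max_left _ _))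
  · exact (hφ.pd1.abs_mollify_le hK p).trans ((le_max_right _ _).trans (le_max_left _ _))
  · exact (hφ.pd2.abs_mollify_le hK p).trans ((le_max_left _ _).trans (le_max_right _ _))
  · exact (hφ.pd1.pd1.abs_mollify_le hK p).trans ((le_max_right _ _).trans (le_max_right _ _))

theorem mollify_holder (hφ : IsTestFunction φ) {f : ℝ × ℝ → ℝ} (hf : Continuous f)
    (h0 : ∀ y, 0 ≤ φ y)
    (h1 : ∫ y, φ y = 1) {A α : ℝ} (hA : ∀ p q, |f p - f q| ≤ A * pdist p q ^ α) (p q : ℝ × ℝ) :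
    |mollify φ f p - mollify φ f q| ≤ A * pdist p q ^ α := by
  have hi : ∀ x, Integrable fun y => φ y * f (x - y) := fun x =>
    (hφ.contDiff.continuous.mul (hf.comp (continuous_const.sub continuous_id))
      ).integrable_of_hasCompactSupport hφ.hasCompactSupport.mul_right
  rw [mollify_eq_swap, mollify_eq_swap, ← integral_sub (hi p) (hi q), ← Real.norm_eq_abs]
  refine (norm_integral_le_of_norm_le (hφ.integrable.const_mul (A * pdist p q ^ α))
    (Filter.Eventually.of_forall fun y => ?_)).trans ?_
  · rw [Real.norm_eq_abs, ← mul_sub, abs_mul, abs_of_nonneg (h0 y), mul_comm]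
    refine mul_le_mul_of_nonneg_right ((hA _ _).trans (le_of_eq ?_)) (h0 y)
    simp [pdist]
  · rw [integral_const_mul, h1, mul_one]

theorem mollify_pd2_const (hφ : IsTestFunction φ) (c : ℝ) (x : ℝ × ℝ) :
    mollify (_root_.pd2 φ) (fun _ => c) x = 0 := by
  rw [← hφ.pd2_mollify continuous_const]
  have : mollify φ (fun _ => c) = fun _ => (∫ y, φ y) * c := by
    ext x
    rw [mollify_eq_swap, integral_mul_const]
  rw [this]
  simp [_root_.pd2]

/-- A distributional solution becomes a classical one after mollification; moreover the
`∂₂`-term on the right-hand side can be absorbed into the unknown. -/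
theorem mollify_equation (hφ : IsTestFunction φ) {a c : ℝ} {u f1 f2 f3 : ℝ × ℝ → ℝ}
    (hu : Continuous u)
    (hf1 : Continuous f1) (hf2 : Continuous f2) (hf3 : Continuous f3)
    (hweak : ∀ φ : ℝ × ℝ → ℝ, ContDiff ℝ (⊤ : ℕ∞) φ → HasCompactSupport φ →
        (∫ x : ℝ × ℝ, u x * (-(_root_.pd2 φ x) - a * _root_.pd1 (_root_.pd1 φ) x + φ x))
          = ∫ x : ℝ × ℝ, (f1 x * _root_.pd1 (_root_.pd1 φ) x - f2 x * _root_.pd2 φ x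
            + f3 x * φ x)) (p : ℝ × ℝ) :
    _root_.pd2 (mollify φ fun y => u y - (f2 y - c)) p
        - a * _root_.pd1 (_root_.pd1 (mollify φ fun y => u y - (f2 y - c))) p
        + mollify φ (fun y => u y - (f2 y - c)) p
      = _root_.pd1 (_root_.pd1 (mollify φ fun y => f1 y + a * (f2 y - c))) p
        + mollify φ (fun y => f3 y - (f2 y - c)) p := by
  have hψ := hφ.const_sub p
  have e1 : ∀ (χ : ℝ × ℝ → ℝ) y, _root_.pd1 (fun y => χ (p - y)) y = -_root_.pd1 χ (p - y) :=
    fun χ y => deriv_comp_const_sub (fun s => χ (s, p.2 - y.2)) p.1 y.1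
  have e2 : ∀ (χ : ℝ × ℝ → ℝ) y, _root_.pd2 (fun y => χ (p - y)) y = -_root_.pd2 χ (p - y) :=
    fun χ y => deriv_comp_const_sub (fun s => χ (p.1 - y.1, s)) p.2 y.2
  have e11 : ∀ y, _root_.pd1 (_root_.pd1 fun y => φ (p - y)) y
      = _root_.pd1 (_root_.pd1 φ) (p - y) := by
    intro y
    rw [funext fun y => e1 φ y]
    have : _root_.pd1 (fun y => -_root_.pd1 φ (p - y)) y
        = -_root_.pd1 (fun y => _root_.pd1 φ (p - y)) y := deriv.fun_neg
    rw [this, e1, neg_neg]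
  have hw := hweak _ hψ.contDiff hψ.hasCompactSupport
  simp only [e2, e11] at hw
  have h2 : Continuous fun y => f2 y - c := by fun_prop
  have h2' : Continuous fun y => a * (f2 y - c) := by fun_prop
  have hd : Continuous fun y => u y - (f2 y - c) := by fun_prop
  have hs : Continuous fun y => f1 y + a * (f2 y - c) := by fun_prop
  have L : mollify (_root_.pd2 φ) u p - a * mollify (_root_.pd1 (_root_.pd1 φ)) u p + mollify φ u p
      = mollify (_root_.pd1 (_root_.pd1 φ)) f1 p + mollify (_root_.pd2 φ) f2 p
        + mollify φ f3 p := by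
    have i : Integrable fun y => u y * _root_.pd2 φ (p - y)
        - a * (u y * _root_.pd1 (_root_.pd1 φ) (p - y)) :=
      (hφ.pd2.integrable_mollify hu p).sub ((hφ.pd1.pd1.integrable_mollify hu p).const_mul a)
    have j : Integrable fun y => f1 y * _root_.pd1 (_root_.pd1 φ) (p - y)
        + f2 y * _root_.pd2 φ (p - y) :=
      (hφ.pd1.pd1.integrable_mollify hf1 p).add (hφ.pd2.integrable_mollify hf2 p)
    unfold mollify
    rw [← integral_const_mul, ← integral_sub (hφ.pd2.integrable_mollify hu p)
      ((hφ.pd1.pd1.integrable_mollify hu p).const_mul a),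
      ← integral_add i (hφ.integrable_mollify hu p),
      ← integral_add (hφ.pd1.pd1.integrable_mollify hf1 p) (hφ.pd2.integrable_mollify hf2 p),
      ← integral_add j (hφ.integrable_mollify hf3 p)]
    convert hw using 1
    · congr 1; ext y; ring
    · congr 1; ext y; ring
  have hmul : mollify (_root_.pd1 (_root_.pd1 φ)) (fun y => a * (f2 y - c)) p
      = a * mollify (_root_.pd1 (_root_.pd1 φ)) (fun y => f2 y - c) p := by
    unfold mollify
    rw [← integral_const_mul]
    simp only [mul_assoc]
  rw [hφ.pd2_mollify hd, hφ.pd1_mollify hd, hφ.pd1.pd1_mollify hd, hφ.pd1_mollify hs,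
    hφ.pd1.pd1_mollify hs, hφ.pd2.mollify_sub hu h2, hφ.pd1.pd1.mollify_sub hu h2,
    hφ.mollify_sub hu h2, hφ.pd1.pd1.mollify_add hf1 h2', hφ.mollify_sub hf3 h2, hmul,
    hφ.pd2.mollify_sub hf2 continuous_const, hφ.mollify_pd2_const]
  linarith

end IsTestFunction


/-! ### Hölder continuity for the parabolic distance -/

theorem pdist_nonneg_s13 (p q : ℝ × ℝ) : 0 ≤ pdist p q := by
  unfold pdist; positivity

theorem continuous_of_holder {f : ℝ × ℝ → ℝ} {A α : ℝ} (hα : 0 < α)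
    (hf : ∀ p q, |f p - f q| ≤ A * pdist p q ^ α) : Continuous f := by
  refine continuous_iff_continuousAt.2 fun q => ?_
  rw [ContinuousAt, tendsto_iff_dist_tendsto_zero]
  have h : Continuous fun p => A * pdist p q ^ α := by
    unfold pdist
    exact continuous_const.mul (Continuous.rpow_const (by fun_prop) fun _ => Or.inr hα.le)
  have h0 := h.tendsto q
  simp only [pdist, sub_self, abs_zero, Real.sqrt_zero, add_zero, Real.zero_rpow hα.ne',
    mul_zero] at h0
  exact squeeze_zero (fun _ => dist_nonneg) (fun p => hf p q) h0

theorem holder_const_nonneg {f : ℝ × ℝ → ℝ} {A α : ℝ}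
    (hf : ∀ p q, |f p - f q| ≤ A * pdist p q ^ α) : 0 ≤ A := by
  have := (abs_nonneg _).trans (hf (1, 0) (0, 0))
  simpa [pdist] using this

theorem periodic_abs_sub_le {f : ℝ × ℝ → ℝ} {A α : ℝ} (hα : 0 < α) (hα1 : α < 1)
    (hp : ∀ x : ℝ × ℝ, f (x.1 + 1, x.2) = f x ∧ f (x.1, x.2 + 1) = f x)
    (hf : ∀ p q, |f p - f q| ≤ A * pdist p q ^ α) (p : ℝ × ℝ) : |f p - f 0| ≤ 2 * A := by
  have h1 : ∀ t, Function.Periodic (fun s => f (s, t)) 1 := fun t s => (hp (s, t)).1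
  have h2 : ∀ s, Function.Periodic (fun t => f (s, t)) 1 := fun s t => (hp (s, t)).2
  have e : f p = f (Int.fract p.1, Int.fract p.2) := by
    have i1 := (h1 p.2).sub_int_mul_eq (x := p.1) ⌊p.1⌋
    have i2 := (h2 (Int.fract p.1)).sub_int_mul_eq (x := p.2) ⌊p.2⌋
    simp only [mul_one, Int.self_sub_floor] at i1 i2
    rw [i2, i1]
  rw [e, mul_comm]
  refine (hf _ _).trans (mul_le_mul_of_nonneg_left ?_ (holder_const_nonneg hf))
  have hd : pdist (Int.fract p.1, Int.fract p.2) 0 ≤ 2 := by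
    have : √(Int.fract p.2) ≤ 1 := Real.sqrt_le_one.2 (Int.fract_lt_one _).le
    simp only [pdist, Prod.fst_zero, Prod.snd_zero, sub_zero,
      abs_of_nonneg (Int.fract_nonneg p.1), abs_of_nonneg (Int.fract_nonneg p.2)]
    linarith [(Int.fract_lt_one p.1).le]
  calc _ ≤ (2 : ℝ) ^ α := Real.rpow_le_rpow (pdist_nonneg_s13 _ _) hd hα.le
    _ ≤ (2 : ℝ) ^ (1 : ℝ) := Real.rpow_le_rpow_of_exponent_le (by norm_num) hα1.le
    _ = 2 := Real.rpow_one 2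

theorem exists_tendsto_mollify : ∃ φ : ℕ → ℝ × ℝ → ℝ, (∀ n, IsTestFunction (φ n)) ∧
    (∀ n y, 0 ≤ φ n y) ∧ (∀ n, ∫ y, φ n y = 1) ∧ ∀ f : ℝ × ℝ → ℝ, Continuous f → ∀ p,
      Filter.Tendsto (fun n => mollify (φ n) f p) Filter.atTop (nhds (f p)) := by
  let φ : ℕ → ContDiffBump (0 : ℝ × ℝ) := fun n =>
    ⟨1 / (n + 1 : ℝ) / 2, 1 / (n + 1 : ℝ), by positivity, half_lt_self (by positivity)⟩
  refine ⟨fun n => (φ n).normed volume, fun n => ⟨(φ n).contDiff_normed,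
    (φ n).hasCompactSupport_normed⟩, fun n => (φ n).nonneg_normed,
    fun n => (φ n).integral_normed, fun f hf p => ?_⟩
  simp only [mollify_eq_convolution]
  exact ContDiffBump.convolution_tendsto_right_of_continuous
    tendsto_one_div_add_atTop_nhds_zero_nat hf p

/-! ### The Schauder estimate for distributional solutions -/

/-- `u` solves `(∂₂ - a∂₁² + 1) u = ∂₁²f1 + ∂₂f2 + f3` in the sense of distributions. -/
def IsWeakSolution (a : ℝ) (u f1 f2 f3 : ℝ × ℝ → ℝ) : Prop :=
  ∀ φ : ℝ × ℝ → ℝ, ContDiff ℝ (⊤ : ℕ∞) φ → HasCompactSupport φ →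
    (∫ x : ℝ × ℝ, u x * (-(pd2 φ x) - a * pd1 (pd1 φ) x + φ x))
      = ∫ x : ℝ × ℝ, (f1 x * pd1 (pd1 φ) x - f2 x * pd2 φ x + f3 x * φ x)

theorem schauder_of_isWeakSolution {α lam : ℝ} (hα : 0 < α) (hα1 : α < 1) (hlam : 0 < lam) :
    ∃ N : ℝ, 1 ≤ N ∧ ∀ a, lam ≤ a → a ≤ 1 → ∀ u f1 f2 f3 : ℝ × ℝ → ℝ,
      IsWeakSolution a u f1 f2 f3 → ∀ A1 A2 B2 B : ℝ,
      (∃ K, (∀ x, |u x| ≤ K) ∧ ∀ x y, |u x - u y| ≤ K * pdist x y ^ α) →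
      (∃ K, ∀ x, |f1 x| ≤ K) → (∀ x y, |f1 x - f1 y| ≤ A1 * pdist x y ^ α) →
      (∀ x y, |f2 x - f2 y| ≤ A2 * pdist x y ^ α) → (∀ x, |f2 x - f2 0| ≤ B2) →
      Continuous f3 → (∀ x, |f3 x| ≤ B) →
      (∀ x, |u x| ≤ N * (A1 + A2 + B2 + B)) ∧
        ∀ x y, |u x - u y| ≤ N * (A1 + A2 + B2 + B) * pdist x y ^ α := by
  obtain ⟨D, hD, H⟩ := schauder_of_heat_equation hα hα1 (b₀ := √(2 * lam)) (by positivity)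
  refine ⟨D + 1, by linarith, ?_⟩
  intro a ha ha1 u f1 f2 f3 hweak A1 A2 B2 B ⟨K, huK, huH⟩ ⟨K1, hf1K⟩ hf1 hf2 hf2B hf3 hB
  have a0 : 0 ≤ a := hlam.le.trans ha
  have hA1 := holder_const_nonneg hf1
  have hA2 := holder_const_nonneg hf2
  have hB2 := (abs_nonneg _).trans (hf2B 0)
  have hB0 := (abs_nonneg _).trans (hB 0)
  have cu := continuous_of_holder hα huH
  have c1 := continuous_of_holder hα hf1
  have c2 := continuous_of_holder hα hf2
  have ch : Continuous fun y => f2 y - f2 0 := by fun_prop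
  have cw : Continuous fun y => u y - (f2 y - f2 0) := by fun_prop
  have cF : Continuous fun y => f1 y + a * (f2 y - f2 0) := by fun_prop
  have cg : Continuous fun y => f3 y - (f2 y - f2 0) := by fun_prop
  have hh : ∀ x y, |(f2 x - f2 0) - (f2 y - f2 0)| ≤ A2 * pdist x y ^ α := fun x y => by
    rw [sub_sub_sub_cancel_right]; exact hf2 x y
  have hw : ∀ x y, |(u x - (f2 x - f2 0)) - (u y - (f2 y - f2 0))|
      ≤ (K + A2) * pdist x y ^ α := fun x y => by
    rw [sub_sub_sub_comm, add_mul]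
    exact (abs_sub _ _).trans (add_le_add (huH x y) (hh x y))
  have hF : ∀ x y, |(f1 x + a * (f2 x - f2 0)) - (f1 y + a * (f2 y - f2 0))|
      ≤ (A1 + A2) * pdist x y ^ α := fun x y => by
    rw [add_sub_add_comm, ← mul_sub, add_mul]
    refine (abs_add_le _ _).trans (add_le_add (hf1 x y) ?_)
    rw [abs_mul, abs_of_nonneg a0]
    exact (mul_le_of_le_one_left (abs_nonneg _) ha1).trans (hh x y)
  have hd : ∀ x y t : ℝ, pdist (x, t) (y, t) = |x - y| := by simp [pdist]
  obtain ⟨φ, hφ, φ0, φ1, hlim⟩ := exists_tendsto_mollify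
  have hφ1 : ∀ n, ∫ y, |φ n y| = 1 := fun n => by simp only [abs_of_nonneg (φ0 n _), φ1]
  have b2 : (√(2 * a)) ^ 2 / 2 = a := by rw [Real.sq_sqrt (by positivity)]; ring
  have key : ∀ n, (∀ x, |mollify (φ n) u x| ≤ (D + 1) * (A1 + A2 + B2 + B)) ∧
      ∀ x y, |mollify (φ n) u x - mollify (φ n) u y|
        ≤ (D + 1) * (A1 + A2 + B2 + B) * pdist x y ^ α := by
    intro n
    have hb : √(2 * a) ≤ 2 := Real.sqrt_le_iff.2 ⟨by norm_num, by linarith⟩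
    obtain ⟨P, Q⟩ := H (√(2 * a)) (Real.sqrt_le_sqrt (by linarith)) hb
      (mollify (φ n) fun y => u y - (f2 y - f2 0))
      (mollify (φ n) fun y => f1 y + a * (f2 y - f2 0))
      (mollify (φ n) fun y => f3 y - (f2 y - f2 0))
      ((hφ n).isBoundedSmooth_mollify cw (K := K + B2) fun y =>
        (abs_sub _ _).trans (add_le_add (huK y) (hf2B y)))
      ((hφ n).isBoundedSmooth_mollify cF (K := K1 + B2) fun y =>
        (abs_add_le _ _).trans (add_le_add (hf1K y) (by
          rw [abs_mul, abs_of_nonneg a0]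
          exact (mul_le_of_le_one_left (abs_nonneg _) ha1).trans (hf2B y))))
      ((hφ n).contDiff_mollify cg).continuous (A1 + A2) (B + B2) (by positivity)
      (fun p => ((hφ n).abs_mollify_le (K := B + B2) (fun y =>
        (abs_sub _ _).trans (add_le_add (hB y) (hf2B y))) p).trans_eq (by rw [hφ1, mul_one]))
      (fun x y t => by
        simpa only [hd] using (hφ n).mollify_holder cF (φ0 n) (φ1 n) hF (x, t) (y, t))
      ⟨K + A2, fun x y t => by
        simpa only [hd] using (hφ n).mollify_holder cw (φ0 n) (φ1 n) hw (x, t) (y, t)⟩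
      (by rw [b2]; exact (hφ n).mollify_equation cu c1 c2 hf3 hweak)
    have hs : ∀ x, mollify (φ n) u x = mollify (φ n) (fun y => u y - (f2 y - f2 0)) x
        + mollify (φ n) (fun y => f2 y - f2 0) x := fun x => by
      rw [(hφ n).mollify_sub cu ch]; ring
    have hHb : ∀ x, |mollify (φ n) (fun y => f2 y - f2 0) x| ≤ B2 := fun x =>
      ((hφ n).abs_mollify_le hf2B x).trans_eq (by rw [hφ1, mul_one])
    have hHh := (hφ n).mollify_holder ch (φ0 n) (φ1 n) hh
    refine ⟨fun x => ?_, fun x y => ?_⟩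
    · rw [hs]
      refine (abs_add_le _ _).trans ((add_le_add (P x) (hHb x)).trans ?_)
      linarith
    · rw [hs, hs, add_sub_add_comm]
      refine (abs_add_le _ _).trans ((add_le_add (Q x y) (hHh x y)).trans ?_)
      rw [← add_mul]
      refine mul_le_mul_of_nonneg_right ?_ (Real.rpow_nonneg (pdist_nonneg_s13 _ _) _)
      linarith
  exact ⟨fun x => le_of_tendsto' (hlim u cu x).abs fun n => (key n).1 x,
    fun x y => le_of_tendsto' ((hlim u cu x).sub (hlim u cu y)).abs fun n => (key n).2 x y⟩

/-- Schauder-type estimate for the space-time periodic constant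
coefficient solutions `v(·, a₀)` of `(∂₂ - a₀∂₁² + 1)v = f` with
`f = ∂₁²f¹ + ∂₂f² + f³`, including two parameter derivatives. -/
theorem periodic_constant_coefficient_schauder
    (α lam : ℝ) (hα : 0 < α) (hα1 : α < 1) (hlam : 0 < lam) :
    ∃ C : ℝ, ∀ (f1 f2 f3 : ℝ × ℝ → ℝ) (v : ℝ × ℝ → ℝ → ℝ) (A1 A2 A3 B : ℝ),
      (∀ x : ℝ × ℝ, f1 (x.1 + 1, x.2) = f1 x ∧ f1 (x.1, x.2 + 1) = f1 x) →
      (∀ x : ℝ × ℝ, f2 (x.1 + 1, x.2) = f2 x ∧ f2 (x.1, x.2 + 1) = f2 x) →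
      (∀ x : ℝ × ℝ, f3 (x.1 + 1, x.2) = f3 x ∧ f3 (x.1, x.2 + 1) = f3 x) →
      (∀ x y : ℝ × ℝ, |f1 x - f1 y| ≤ A1 * pdist x y ^ α) →
      (∀ x y : ℝ × ℝ, |f2 x - f2 y| ≤ A2 * pdist x y ^ α) →
      (∀ x y : ℝ × ℝ, |f3 x - f3 y| ≤ A3 * pdist x y ^ α) →
      (∀ x : ℝ × ℝ, |f3 x| ≤ B) →
      (∀ a₀ ∈ Set.Icc lam 1, ∀ x : ℝ × ℝ,
        v (x.1 + 1, x.2) a₀ = v x a₀ ∧ v (x.1, x.2 + 1) a₀ = v x a₀) →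
      (∀ x : ℝ × ℝ, ContDiff ℝ 2 (fun a : ℝ => v x a)) →
      (∀ a₀ ∈ Set.Icc lam 1, ∀ m : ℕ, m ≤ 2 → ∃ K : ℝ,
        (∀ x : ℝ × ℝ, |iteratedDeriv m (fun a : ℝ => v x a) a₀| ≤ K) ∧
        (∀ x y : ℝ × ℝ,
          |iteratedDeriv m (fun a : ℝ => v x a) a₀
            - iteratedDeriv m (fun a : ℝ => v y a) a₀| ≤ K * pdist x y ^ α)) →
      (∀ a₀ ∈ Set.Icc lam 1, ∀ φ : ℝ × ℝ → ℝ, ContDiff ℝ (⊤ : ℕ∞) φ → HasCompactSupport φ →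
        (∫ x : ℝ × ℝ, v x a₀ * (-(pd2 φ x) - a₀ * pd1 (pd1 φ) x + φ x))
          = ∫ x : ℝ × ℝ, (f1 x * pd1 (pd1 φ) x - f2 x * pd2 φ x + f3 x * φ x)) →
      (∀ a₀ ∈ Set.Icc lam 1, ∀ φ : ℝ × ℝ → ℝ, ContDiff ℝ (⊤ : ℕ∞) φ → HasCompactSupport φ →
        (∫ x : ℝ × ℝ, deriv (fun a : ℝ => v x a) a₀ * (-(pd2 φ x) - a₀ * pd1 (pd1 φ) x + φ x))
          = ∫ x : ℝ × ℝ, v x a₀ * pd1 (pd1 φ) x) →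
      (∀ a₀ ∈ Set.Icc lam 1, ∀ φ : ℝ × ℝ → ℝ, ContDiff ℝ (⊤ : ℕ∞) φ → HasCompactSupport φ →
        (∫ x : ℝ × ℝ, iteratedDeriv 2 (fun a : ℝ => v x a) a₀
            * (-(pd2 φ x) - a₀ * pd1 (pd1 φ) x + φ x))
          = 2 * ∫ x : ℝ × ℝ, deriv (fun a : ℝ => v x a) a₀ * pd1 (pd1 φ) x) →
      ∀ a₀ ∈ Set.Icc lam 1, ∀ m : ℕ, m ≤ 2 →
        (∀ x : ℝ × ℝ,
          |iteratedDeriv m (fun a : ℝ => v x a) a₀| ≤ C * (A1 + A2 + A3 + B)) ∧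
        (∀ x y : ℝ × ℝ,
          |iteratedDeriv m (fun a : ℝ => v x a) a₀
            - iteratedDeriv m (fun a : ℝ => v y a) a₀|
            ≤ C * (A1 + A2 + A3 + B) * pdist x y ^ α) := by
  obtain ⟨N, hN, H⟩ := schauder_of_isWeakSolution hα hα1 hlam
  have hN0 : 0 ≤ N := by linarith
  refine ⟨6 * N ^ 3, ?_⟩
  intro f1 f2 f3 v A1 A2 A3 B p1 p2 _ h1 h2 h3 hB _ _ hreg w0 w1 w2 a ha
  have hA1 := holder_const_nonneg h1
  have hA2 := holder_const_nonneg h2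
  have hA3 := holder_const_nonneg h3
  have hB0 := (abs_nonneg _).trans (hB 0)
  have r0 := hreg a ha 0 (by norm_num)
  have r1 := hreg a ha 1 (by norm_num)
  have r2 := hreg a ha 2 le_rfl
  simp only [iteratedDeriv_zero] at r0
  simp only [iteratedDeriv_one] at r1
  have z2 : ∀ x y : ℝ × ℝ, |(0 : ℝ) - 0| ≤ 0 * pdist x y ^ α := by simp
  obtain ⟨u0, u0'⟩ := H a ha.1 ha.2 (fun x => v x a) f1 f2 f3 (w0 a ha) A1 A2 (2 * A2) B r0
    ⟨2 * A1 + |f1 0|, fun x => by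
      have := abs_add_le (f1 x - f1 0) (f1 0)
      rw [sub_add_cancel] at this
      linarith [periodic_abs_sub_le hα hα1 p1 h1 x]⟩
    h1 h2 (periodic_abs_sub_le hα hα1 p2 h2) (continuous_of_holder hα h3) hB
  set M0 := N * (A1 + A2 + 2 * A2 + B)
  obtain ⟨u1, u1'⟩ := H a ha.1 ha.2 (fun x => deriv (fun b => v x b) a) (fun x => v x a)
    (fun _ => 0) (fun _ => 0) (fun φ hφ hc => by simpa using w1 a ha φ hφ hc)
    M0 0 0 0 r1 ⟨M0, u0⟩ u0' z2 (by simp) continuous_const (by simp)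
  simp only [add_zero] at u1 u1'
  obtain ⟨u2, u2'⟩ := H a ha.1 ha.2 (fun x => iteratedDeriv 2 (fun b => v x b) a)
    (fun x => 2 * deriv (fun b => v x b) a) (fun _ => 0) (fun _ => 0)
    (fun φ hφ hc => by
      simpa [mul_assoc, integral_const_mul] using w2 a ha φ hφ hc)
    (2 * (N * M0)) 0 0 0 r2
    ⟨2 * (N * M0), fun x => by rw [abs_mul, abs_two]; linarith [u1 x]⟩
    (fun x y => by rw [← mul_sub, abs_mul, abs_two]; linarith [u1' x y])
    z2 (by simp) continuous_const (by simp)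
  simp only [add_zero] at u2 u2'
  have hS : 0 ≤ A1 + A2 + A3 + B := by positivity
  have hM0 : 0 ≤ M0 := by positivity
  have hNM : M0 ≤ N * M0 := le_mul_of_one_le_left hM0 hN
  have hNNM : N * M0 ≤ N * (N * M0) := mul_le_mul_of_nonneg_left hNM hN0
  have m2 : N * (2 * (N * M0)) ≤ 6 * N ^ 3 * (A1 + A2 + A3 + B) := by
    calc N * (2 * (N * M0)) = 2 * N ^ 3 * (A1 + A2 + 2 * A2 + B) := by simp only [M0]; ring
      _ ≤ 2 * N ^ 3 * (3 * (A1 + A2 + A3 + B)) :=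
        mul_le_mul_of_nonneg_left (by linarith) (by positivity)
      _ = _ := by ring
  have m1 : N * M0 ≤ 6 * N ^ 3 * (A1 + A2 + A3 + B) := by linarith
  have m0 : M0 ≤ 6 * N ^ 3 * (A1 + A2 + A3 + B) := by linarith
  have hp : ∀ x y, 0 ≤ pdist x y ^ α := fun x y => Real.rpow_nonneg (pdist_nonneg_s13 x y) α
  intro m hm
  interval_cases m
  · simp only [iteratedDeriv_zero]
    exact ⟨fun x => (u0 x).trans m0,
      fun x y => (u0' x y).trans (mul_le_mul_of_nonneg_right m0 (hp x y))⟩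
  · simp only [iteratedDeriv_one]
    exact ⟨fun x => (u1 x).trans m1,
      fun x y => (u1' x y).trans (mul_le_mul_of_nonneg_right m1 (hp x y))⟩
  · exact ⟨fun x => (u2 x).trans m2,
      fun x y => (u2' x y).trans (mul_le_mul_of_nonneg_right m2 (hp x y))⟩
end
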